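/- Second-order convergence of the MAC-E stresses: there exist constants C > 0 and h₀ > 0, depending only on μ and the mesh-regularity constant C₀ (in particular independent of h and l), such that if max(h, l) ≤ h₀ and (W^x, W^y, Z^{11}, Z^{22}, Z^{12}) solves the MAC-E scheme with data f¹, f² computed from the exact solution, then ‖Z^{12} − σ^{12}‖_T ≤ Cμ(h²+l²)(‖u‖_{3,∞} + ‖σ‖_{3,∞}), ‖Z^{11} − σ^{11}‖_M ≤ C(λ+μ)(h²+l²)(‖u‖_{3,∞} + ‖σ‖_{3,∞}), and ‖Z^{22} − σ^{22}‖_M ≤ C(λ+μ)(h²+l²)(‖u‖_{3,∞} + ‖σ‖_{3,∞}), where σ^{12} is evaluated at the grid nodes (x_i, y_j) and σ^{11}, σ^{22} at the cell centers (x_{i+1/2}, y_{j+1/2}). -/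

import Mathlib

open Finset

noncomputable section

/-- The midpoint `x_{i+1/2} = (x_i + x_{i+1})/2`. -/
def midpt (x : ℕ → ℝ) (i : ℕ) : ℝ := (x i + x (i + 1)) / 2

/-- The cell width `h_{i+1/2} = x_{i+1} - x_i`. -/
def hMid (x : ℕ → ℝ) (i : ℕ) : ℝ := x (i + 1) - x i

/-- `h_i = x_{i+1/2} - x_{i-1/2}` for `1 ≤ i ≤ n-1`, together with the boundary
conventions `h_0 = h_{1/2}/2` and `h_n = h_{n-1/2}/2`. -/
def hNode (x : ℕ → ℝ) (n i : ℕ) : ℝ :=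
  if i = 0 then hMid x 0 / 2
  else if i = n then hMid x (n - 1) / 2
  else midpt x i - midpt x (i - 1)

/-- `0 = x_0 < x_1 < ⋯ < x_n = 1`. -/
def IsGrid (x : ℕ → ℝ) (n : ℕ) : Prop :=
  x 0 = 0 ∧ x n = 1 ∧ ∀ i < n, x i < x (i + 1)

/-- Discrete inner product `(φ,θ)_M` over the cell centers `(x_{i+1/2}, y_{j+1/2})`. -/
def ipM (x y : ℕ → ℝ) (nx ny : ℕ) (φ θ : ℕ → ℕ → ℝ) : ℝ :=
  ∑ i ∈ range nx, ∑ j ∈ range ny, hMid x i * hMid y j * φ i j * θ i j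

/-- Discrete inner product `(φ,θ)_T` over the grid nodes `(x_i, y_j)`. -/
def ipT (x y : ℕ → ℝ) (nx ny : ℕ) (φ θ : ℕ → ℕ → ℝ) : ℝ :=
  ∑ i ∈ range (nx + 1), ∑ j ∈ range (ny + 1), hNode x nx i * hNode y ny j * φ i j * θ i j

/-- Discrete inner product `(φ,θ)_{TM}` over the points `(x_i, y_{j+1/2})`,
`1 ≤ i ≤ n_x - 1`, `0 ≤ j ≤ n_y - 1`. -/
def ipTM (x y : ℕ → ℝ) (nx ny : ℕ) (φ θ : ℕ → ℕ → ℝ) : ℝ :=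
  ∑ i ∈ Ico 1 nx, ∑ j ∈ range ny, hNode x nx i * hMid y j * φ i j * θ i j

/-- Discrete inner product `(φ,θ)_{MT}` over the points `(x_{i+1/2}, y_j)`,
`0 ≤ i ≤ n_x - 1`, `1 ≤ j ≤ n_y - 1`. -/
def ipMT (x y : ℕ → ℝ) (nx ny : ℕ) (φ θ : ℕ → ℕ → ℝ) : ℝ :=
  ∑ i ∈ range nx, ∑ j ∈ Ico 1 ny, hMid x i * hNode y ny j * φ i j * θ i j

/-- `D_y` of an edge function `v` given at `(x-index, y_{j+1/2})` with extra boundary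
rows `v0` (at `y_0`) and `vn` (at `y_{n_y}`); the result is a node function. -/
def DyE (y : ℕ → ℝ) (ny : ℕ) (v : ℕ → ℕ → ℝ) (v0 vn : ℕ → ℝ) (i j : ℕ) : ℝ :=
  if j = 0 then (v i 0 - v0 i) / hNode y ny 0
  else if j = ny then (vn i - v i (ny - 1)) / hNode y ny ny
  else (v i j - v i (j - 1)) / hNode y ny j

/-- `D_x` of an edge function `v` given at `(x_{i+1/2}, y-index)` with extra boundary
columns `v0` (at `x_0`) and `vn` (at `x_{n_x}`); the result is a node function. -/
def DxE (x : ℕ → ℝ) (nx : ℕ) (v : ℕ → ℕ → ℝ) (v0 vn : ℕ → ℝ) (i j : ℕ) : ℝ :=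
  if i = 0 then (v 0 j - v0 j) / hNode x nx 0
  else if i = nx then (vn j - v (nx - 1) j) / hNode x nx nx
  else (v i j - v (i - 1) j) / hNode x nx i

/-- The MAC-E scheme on the staggered grid: `(Wx, Wy, Z11, Z22, Z12)` (with the extra
boundary rows/columns `Wx0, Wxn` of `Wx` at `y = y_0, y_{n_y}` and `Wy0, Wyn` of `Wy`
at `x = x_0, x_{n_x}`) solves the scheme with data `f1, f2`. -/
def MACESol (nx ny : ℕ) (x y : ℕ → ℝ) (lam mu : ℝ)
    (Wx : ℕ → ℕ → ℝ) (Wx0 Wxn : ℕ → ℝ)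
    (Wy : ℕ → ℕ → ℝ) (Wy0 Wyn : ℕ → ℝ)
    (Z11 Z22 Z12 f1 f2 : ℕ → ℕ → ℝ) : Prop :=
  -- boundary conditions for the displacements
  (∀ j < ny, Wx 0 j = 0 ∧ Wx nx j = 0) ∧
  (∀ i ≤ nx, Wx0 i = 0 ∧ Wxn i = 0) ∧
  (∀ i < nx, Wy i 0 = 0 ∧ Wy i ny = 0) ∧
  (∀ j ≤ ny, Wy0 j = 0 ∧ Wyn j = 0) ∧
  -- constitutive equations at the cell centers
  (∀ i < nx, ∀ j < ny,
    (1 / (2 * mu)) * (Z11 i j - lam / (2 * lam + 2 * mu) * (Z11 i j + Z22 i j))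
      = (Wx (i + 1) j - Wx i j) / hMid x i) ∧
  (∀ i < nx, ∀ j < ny,
    (1 / (2 * mu)) * (Z22 i j - lam / (2 * lam + 2 * mu) * (Z11 i j + Z22 i j))
      = (Wy i (j + 1) - Wy i j) / hMid y j) ∧
  -- shear stress equation at the grid nodes
  (∀ i ≤ nx, ∀ j ≤ ny,
    Z12 i j = mu * (DyE y ny Wx Wx0 Wxn i j + DxE x nx Wy Wy0 Wyn i j)) ∧
  -- momentum equations
  (∀ i, 1 ≤ i → i < nx → ∀ j < ny,
    (Z11 i j - Z11 (i - 1) j) / hNode x nx i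
      + (Z12 i (j + 1) - Z12 i j) / hMid y j = f1 i j) ∧
  (∀ i < nx, ∀ j, 1 ≤ j → j < ny →
    (Z12 (i + 1) j - Z12 i j) / hMid x i
      + (Z22 i j - Z22 i (j - 1)) / hNode y ny j = f2 i j)

/-- First partial derivative in `x`. -/
def pdx (f : ℝ × ℝ → ℝ) (p : ℝ × ℝ) : ℝ := deriv (fun t => f (t, p.2)) p.1

/-- First partial derivative in `y`. -/
def pdy (f : ℝ × ℝ → ℝ) (p : ℝ × ℝ) : ℝ := deriv (fun t => f (p.1, t)) p.2

/-- The norm `‖f‖_{3,∞}`: the sup over `[0,1]²` of the derivatives of `f` of order at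
most `3`. -/
def norm3 (f : ℝ × ℝ → ℝ) : ℝ :=
  ⨆ p : Set.Icc ((0 : ℝ), (0 : ℝ)) ((1 : ℝ), (1 : ℝ)), ⨆ k : Fin 4,
    ‖iteratedFDeriv ℝ (k : ℕ) f (p : ℝ × ℝ)‖

/-- The mesh size `h = max_i h_{i+1/2}`. -/
def hmax (x : ℕ → ℝ) (n : ℕ) : ℝ := ⨆ i : Fin n, hMid x i


/-! ### One-dimensional grids -/

section Grid

variable {x : ℕ → ℝ} {n : ℕ}

lemma IsGrid.hMid_pos (hx : IsGrid x n) {i : ℕ} (hi : i < n) : 0 < hMid x i :=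
  sub_pos.2 (hx.2.2 i hi)

lemma IsGrid.le_of_le (hx : IsGrid x n) {i j : ℕ} (hij : i ≤ j) (hj : j ≤ n) : x i ≤ x j := by
  induction j, hij using Nat.le_induction with
  | base => exact le_rfl
  | succ k _ ih => exact (ih (by omega)).trans (hx.2.2 k (by omega)).le

lemma IsGrid.mem_Icc (hx : IsGrid x n) {i : ℕ} (hi : i ≤ n) : x i ∈ Set.Icc (0 : ℝ) 1 :=
  ⟨hx.1 ▸ hx.le_of_le (Nat.zero_le i) hi, hx.2.1 ▸ hx.le_of_le hi le_rfl⟩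

lemma IsGrid.midpt_mem_Ioo (hx : IsGrid x n) {i : ℕ} (hi : i < n) :
    midpt x i ∈ Set.Ioo (0 : ℝ) 1 := by
  have h0 := (hx.mem_Icc hi.le).1
  have h1 := (hx.mem_Icc (i := i + 1) hi).2
  have h2 := hx.2.2 i hi
  unfold midpt
  constructor <;> linarith

lemma IsGrid.midpt_mem_Icc (hx : IsGrid x n) {i : ℕ} (hi : i < n) :
    midpt x i ∈ Set.Icc (0 : ℝ) 1 :=
  Set.Ioo_subset_Icc_self (hx.midpt_mem_Ioo hi)

lemma hMid_le_hmax {i : ℕ} (hi : i < n) : hMid x i ≤ hmax x n :=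
  le_ciSup (f := fun i : Fin n => hMid x i) (Set.finite_range _).bddAbove ⟨i, hi⟩

lemma IsGrid.hMid_sq_le (hx : IsGrid x n) {i : ℕ} (hi : i < n) :
    hMid x i ^ 2 ≤ hmax x n ^ 2 :=
  pow_le_pow_left₀ (hx.hMid_pos hi).le (hMid_le_hmax hi) 2

lemma IsGrid.sum_hMid (hx : IsGrid x n) : ∑ i ∈ range n, hMid x i = 1 := by
  unfold hMid
  rw [sum_range_sub, hx.1, hx.2.1, sub_zero]

lemma IsGrid.sum_hMid_cube_le (hx : IsGrid x n) :
    ∑ i ∈ range n, hMid x i ^ 3 ≤ hmax x n ^ 2 := by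
  calc ∑ i ∈ range n, hMid x i ^ 3 ≤ ∑ i ∈ range n, hmax x n ^ 2 * hMid x i := by
        refine sum_le_sum fun i hi => ?_
        rw [mem_range] at hi
        have := mul_le_mul_of_nonneg_right (hx.hMid_sq_le hi) (hx.hMid_pos hi).le
        linarith [this, pow_succ (hMid x i) 2]
    _ = hmax x n ^ 2 := by rw [← mul_sum, hx.sum_hMid, mul_one]

lemma hNode_eq (hn : 0 < n) {i : ℕ} (hi : i ≤ n) :
    hNode x n i = (if i < n then hMid x i else 0) / 2 + (if 0 < i then hMid x (i - 1) else 0) / 2 := by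
  unfold hNode
  rcases Nat.eq_zero_or_pos i with rfl | h0
  · simp [hn]
  · rcases hi.eq_or_lt with rfl | h1
    · simp [h0, h0.ne']
    · obtain ⟨k, rfl⟩ : ∃ k, i = k + 1 := ⟨i - 1, by omega⟩
      simp only [h0.ne', h1.ne, h0, h1, if_true, if_false, Nat.add_sub_cancel, midpt, hMid]
      ring

lemma IsGrid.hNode_pos (hx : IsGrid x n) (hn : 0 < n) {i : ℕ} (hi : i ≤ n) : 0 < hNode x n i := by
  rw [hNode_eq hn hi]
  rcases Nat.eq_zero_or_pos i with rfl | h0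
  · simp [hn, hx.hMid_pos hn]
  · have h2 := hx.hMid_pos (i := i - 1) (by omega)
    split_ifs with h
    · have h1 := hx.hMid_pos h
      positivity
    · positivity

lemma IsGrid.sum_hNode (hx : IsGrid x n) (hn : 0 < n) :
    ∑ i ∈ range (n + 1), hNode x n i = 1 := by
  rw [sum_congr rfl fun i hi => hNode_eq hn (Nat.lt_succ_iff.1 (mem_range.1 hi)),
    sum_add_distrib, sum_range_succ, sum_range_succ' _ n]
  have h1 : ∑ i ∈ range n, (if i < n then hMid x i else 0) / 2 = 1 / 2 := by
    rw [← hx.sum_hMid, sum_div]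
    exact sum_congr rfl fun i hi => by rw [if_pos (mem_range.1 hi)]
  have h2 : ∑ i ∈ range n, (if 0 < i + 1 then hMid x (i + 1 - 1) else 0) / 2 = 1 / 2 := by
    rw [← hx.sum_hMid, sum_div]
    exact sum_congr rfl fun i hi => by simp
  rw [h1, h2]
  norm_num

lemma IsGrid.sum_Ico_hNode_le (hx : IsGrid x n) (hn : 0 < n) :
    ∑ i ∈ Ico 1 n, hNode x n i ≤ 1 := by
  rw [← hx.sum_hNode hn]
  refine sum_le_sum_of_subset_of_nonneg (fun i hi => ?_) fun i hi _ => ?_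
  · simp only [mem_Ico, mem_range] at *
    omega
  · exact (hx.hNode_pos hn (Nat.lt_succ_iff.1 (mem_range.1 hi))).le

lemma hNode_mul_DyE (hx : IsGrid x n) (hn : 0 < n) (v : ℕ → ℕ → ℝ) (i : ℕ) {j : ℕ} (hj : j ≤ n) :
    hNode x n j * DyE x n v 0 0 i j =
      (if j < n then v i j else 0) - (if 0 < j then v i (j - 1) else 0) := by
  have hp := (hx.hNode_pos hn hj).ne'
  unfold DyE
  rcases Nat.eq_zero_or_pos j with rfl | h0
  · simp [hn, mul_div_cancel₀ _ hp]
  · rcases hj.eq_or_lt with rfl | h1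
    · simp [h0.ne', h0, mul_div_cancel₀ _ hp]
    · simp [h0.ne', h1.ne, h0, h1, mul_div_cancel₀ _ hp]

/-- Summation by parts for the node difference quotient of an edge function extended by zero. -/
lemma sum_hNode_mul_DyE (hx : IsGrid x n) (hn : 0 < n) (v : ℕ → ℕ → ℝ) (i : ℕ) (E : ℕ → ℝ) :
    ∑ j ∈ range (n + 1), hNode x n j * (E j * DyE x n v 0 0 i j) =
      -∑ j ∈ range n, (E (j + 1) - E j) * v i j := by
  have h : ∀ j ∈ range (n + 1), hNode x n j * (E j * DyE x n v 0 0 i j) =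
      E j * (if j < n then v i j else 0) - E j * (if 0 < j then v i (j - 1) else 0) := by
    intro j hj
    rw [← mul_sub, ← hNode_mul_DyE hx hn v i (Nat.lt_succ_iff.1 (mem_range.1 hj))]
    ring
  rw [sum_congr rfl h, sum_sub_distrib, sum_range_succ,
    sum_range_succ' (fun j => E j * (if 0 < j then v i (j - 1) else 0))]
  have h1 : ∑ j ∈ range n, E j * (if j < n then v i j else 0) = ∑ j ∈ range n, E j * v i j :=
    sum_congr rfl fun j hj => by rw [if_pos (mem_range.1 hj)]
  rw [h1]
  simp [sub_mul, sum_sub_distrib]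

/-- Summation by parts for the cell difference quotient of a function vanishing at both ends. -/
lemma sum_mul_sub_eq_neg_sum_Ico (hn : 0 < n) (E e : ℕ → ℝ) (h0 : e 0 = 0) (h1 : e n = 0) :
    ∑ i ∈ range n, E i * (e (i + 1) - e i) = -∑ i ∈ Ico 1 n, (E i - E (i - 1)) * e i := by
  obtain ⟨m, rfl⟩ : ∃ m, n = m + 1 := ⟨n - 1, by omega⟩
  simp only [mul_sub, sum_sub_distrib, sub_mul]
  rw [sum_range_succ, sum_range_succ' (fun i => E i * e i), sum_Ico_eq_sum_range,
    sum_Ico_eq_sum_range, h0, h1]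
  simp [add_comm 1]

/-- Discrete Poincaré inequality for a function vanishing at the left end. -/
lemma abs_le_sum_abs_sub (e : ℕ → ℝ) (h0 : e 0 = 0) {i : ℕ} (hi : i ≤ n) :
    |e i| ≤ ∑ m ∈ range n, |e (m + 1) - e m| := by
  calc |e i| = |∑ m ∈ range i, (e (m + 1) - e m)| := by rw [sum_range_sub, h0, sub_zero]
    _ ≤ ∑ m ∈ range i, |e (m + 1) - e m| := abs_sum_le_sum_abs _ _
    _ ≤ _ := sum_le_sum_of_subset_of_nonneg (range_mono hi) fun _ _ _ => abs_nonneg _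

lemma abs_DyE_sub_le (hx : IsGrid x n) (hn : 0 < n) {v : ℕ → ℕ → ℝ} {i : ℕ} {c d : ℕ → ℝ} {K : ℝ}
    (hl : ∀ j < n, |v i j - (c j + d j * hMid x j / 2)| ≤ K * hMid x j)
    (hr : ∀ j < n, |v i j - (c (j + 1) - d (j + 1) * hMid x j / 2)| ≤ K * hMid x j)
    (h0 : c 0 = 0) (h1 : c n = 0) {j : ℕ} (hj : j ≤ n) :
    |DyE x n v 0 0 i j - d j| ≤ 2 * K := by
  have hp := hx.hNode_pos hn hj
  have key : |hNode x n j * (DyE x n v 0 0 i j - d j)| ≤ hNode x n j * (2 * K) := by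
    rw [mul_sub, hNode_mul_DyE hx hn v i hj, hNode_eq hn hj]
    rcases Nat.eq_zero_or_pos j with rfl | hj0
    · have := abs_le.1 (hl 0 hn)
      simp only [hn, if_true, lt_irrefl, if_false]
      rw [abs_le]
      constructor <;> linarith
    · obtain ⟨k, rfl⟩ : ∃ k, j = k + 1 := ⟨j - 1, by omega⟩
      have hk := abs_le.1 (hr k (by omega))
      rcases hj.eq_or_lt with rfl | hj1
      · simp only [hj0, if_true, lt_irrefl, if_false, Nat.add_sub_cancel]
        rw [abs_le]
        constructor <;> linarith
      · have := abs_le.1 (hl (k + 1) hj1)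
        simp only [hj0, hj1, if_true, Nat.add_sub_cancel]
        rw [abs_le]
        constructor <;> linarith
  rw [abs_mul, abs_of_pos hp] at key
  exact le_of_mul_le_mul_left key hp

end Grid

/-! ### Coarse Taylor estimates on the unit interval -/

section Taylor

lemma abs_le_of_abs_deriv_le {F F' : ℝ → ℝ} {s M : ℝ} {n : ℕ} (hM : 0 ≤ M)
    (hs : s ∈ Set.Icc (0 : ℝ) 1) (hF : ∀ t, HasDerivAt F (F' t) t) (h0 : F s = 0)
    (hb : ∀ t ∈ Set.Icc (0 : ℝ) 1, |F' t| ≤ M * |t - s| ^ n) :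
    ∀ t ∈ Set.Icc (0 : ℝ) 1, |F t| ≤ M * |t - s| ^ (n + 1) := by
  intro t ht
  have hsub : Set.uIcc s t ⊆ Set.Icc (0 : ℝ) 1 := Set.uIcc_subset_Icc hs ht
  have h := (convex_uIcc s t).norm_image_sub_le_of_norm_hasDerivWithin_le (f := F) (f' := F')
    (C := M * |t - s| ^ n) (fun z _ => (hF z).hasDerivWithinAt) (fun z hz => ?_)
    Set.left_mem_uIcc Set.right_mem_uIcc
  · rw [h0, sub_zero, Real.norm_eq_abs, Real.norm_eq_abs] at h
    rwa [pow_succ, ← mul_assoc]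
  · refine (hb z (hsub hz)).trans ?_
    gcongr M * ?_ ^ n
    exact Set.abs_sub_left_of_mem_uIcc hz

variable {G g g₁ g₂ g₃ : ℝ → ℝ} {s t M : ℝ}

lemma abs_sub_le_of_deriv (hM : 0 ≤ M) (hg : ∀ t, HasDerivAt g (g₁ t) t)
    (hb : ∀ t ∈ Set.Icc (0 : ℝ) 1, |g₁ t| ≤ M) (hs : s ∈ Set.Icc (0 : ℝ) 1)
    (ht : t ∈ Set.Icc (0 : ℝ) 1) : |g t - g s| ≤ M * |t - s| := by
  have := abs_le_of_abs_deriv_le (F := fun t => g t - g s) (n := 0) hM hs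
    (fun t => (hg t).sub_const _) (sub_self _) (by simpa using hb) t ht
  simpa using this

lemma abs_taylor_two_le (hM : 0 ≤ M) (hg : ∀ t, HasDerivAt g (g₁ t) t)
    (hg₁ : ∀ t, HasDerivAt g₁ (g₂ t) t)
    (hb : ∀ t ∈ Set.Icc (0 : ℝ) 1, |g₂ t| ≤ M) (hs : s ∈ Set.Icc (0 : ℝ) 1)
    (ht : t ∈ Set.Icc (0 : ℝ) 1) : |g t - g s - g₁ s * (t - s)| ≤ M * |t - s| ^ 2 := by
  refine abs_le_of_abs_deriv_le (F := fun t => g t - g s - g₁ s * (t - s))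
    (F' := fun t => g₁ t - g₁ s) (n := 1) hM hs (fun t => ?_) (by simp) (fun t ht => ?_) t ht
  · exact (((hg t).sub_const (g s)).fun_sub
      (((hasDerivAt_id' t).sub_const s).const_mul (g₁ s))).congr_deriv (by ring)
  · simpa using abs_sub_le_of_deriv hM hg₁ hb hs ht

lemma abs_taylor_three_le (hM : 0 ≤ M) (hg : ∀ t, HasDerivAt g (g₁ t) t)
    (hg₁ : ∀ t, HasDerivAt g₁ (g₂ t) t) (hg₂ : ∀ t, HasDerivAt g₂ (g₃ t) t)
    (hb : ∀ t ∈ Set.Icc (0 : ℝ) 1, |g₃ t| ≤ M) (hs : s ∈ Set.Icc (0 : ℝ) 1)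
    (ht : t ∈ Set.Icc (0 : ℝ) 1) :
    |g t - g s - g₁ s * (t - s) - g₂ s * (t - s) ^ 2 / 2| ≤ M * |t - s| ^ 3 := by
  refine abs_le_of_abs_deriv_le
    (F := fun t => g t - g s - g₁ s * (t - s) - g₂ s * (t - s) ^ 2 / 2)
    (F' := fun t => g₁ t - g₁ s - g₂ s * (t - s)) (n := 2) hM hs (fun t => ?_) (by simp)
    (fun t ht => abs_taylor_two_le hM hg₁ hg₂ hb hs ht) t ht
  have h1 := ((hg t).sub_const (g s)).fun_sub (((hasDerivAt_id' t).sub_const s).const_mul (g₁ s))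
  have h2 := ((((hasDerivAt_id' t).sub_const s).fun_pow 2).const_mul (g₂ s)).div_const 2
  exact (h1.fun_sub h2).congr_deriv (by norm_num; ring)

lemma abs_taylor_four_le {g₄ : ℝ → ℝ} (hM : 0 ≤ M) (hg : ∀ t, HasDerivAt g (g₁ t) t)
    (hg₁ : ∀ t, HasDerivAt g₁ (g₂ t) t) (hg₂ : ∀ t, HasDerivAt g₂ (g₃ t) t)
    (hg₃ : ∀ t, HasDerivAt g₃ (g₄ t) t)
    (hb : ∀ t ∈ Set.Icc (0 : ℝ) 1, |g₄ t| ≤ M) (hs : s ∈ Set.Icc (0 : ℝ) 1)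
    (ht : t ∈ Set.Icc (0 : ℝ) 1) :
    |g t - g s - g₁ s * (t - s) - g₂ s * (t - s) ^ 2 / 2 - g₃ s * (t - s) ^ 3 / 6|
      ≤ M * |t - s| ^ 4 := by
  refine abs_le_of_abs_deriv_le
    (F := fun t => g t - g s - g₁ s * (t - s) - g₂ s * (t - s) ^ 2 / 2 - g₃ s * (t - s) ^ 3 / 6)
    (F' := fun t => g₁ t - g₁ s - g₂ s * (t - s) - g₃ s * (t - s) ^ 2 / 2) (n := 3) hM hs
    (fun t => ?_) (by simp)
    (fun t ht => abs_taylor_three_le hM hg₁ hg₂ hg₃ hb hs ht) t ht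
  have h1 := ((hg t).sub_const (g s)).fun_sub (((hasDerivAt_id' t).sub_const s).const_mul (g₁ s))
  have h2 := ((((hasDerivAt_id' t).sub_const s).fun_pow 2).const_mul (g₂ s)).div_const 2
  have h3 := ((((hasDerivAt_id' t).sub_const s).fun_pow 3).const_mul (g₃ s)).div_const 6
  exact ((h1.fun_sub h2).fun_sub h3).congr_deriv (by norm_num; ring)

lemma hasDerivAt_integral_left_fixed (hg : Continuous g) (s t : ℝ) :
    HasDerivAt (fun t => ∫ r in s..t, g r) (g t) t :=
  intervalIntegral.integral_hasDerivAt_right (hg.intervalIntegrable _ _)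
    (hg.stronglyMeasurableAtFilter _ _) hg.continuousAt

/-- The mean value of a Lipschitz function over a cell is close to its endpoint values. -/
lemma abs_average_sub_le (hM : 0 ≤ M) (hst : s ≠ t) (hg : ∀ t, HasDerivAt g (g₁ t) t)
    (hb : ∀ t ∈ Set.Icc (0 : ℝ) 1, |g₁ t| ≤ M) (hs : s ∈ Set.Icc (0 : ℝ) 1)
    (ht : t ∈ Set.Icc (0 : ℝ) 1) : |(∫ r in s..t, g r) / (t - s) - g s| ≤ M * |t - s| := by
  have hc : Continuous g := continuous_iff_continuousAt.2 fun t => (hg t).continuousAt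
  have h := abs_taylor_two_le hM (hasDerivAt_integral_left_fixed hc s) hg hb hs ht
  have hp : 0 < |t - s| := abs_pos.2 (sub_ne_zero.2 hst.symm)
  refine le_of_mul_le_mul_right ?_ hp
  rw [← abs_mul, sub_mul, div_mul_cancel₀ _ (sub_ne_zero.2 hst.symm)]
  simpa [pow_two, mul_assoc] using h

/-- Third-order expansion of the mean value of a function over a cell, around an endpoint `s`. -/
lemma abs_average_taylor_le (hM : 0 ≤ M) (hst : s ≠ t) (hg : ∀ t, HasDerivAt g (g₁ t) t)
    (hg₁ : ∀ t, HasDerivAt g₁ (g₂ t) t) (hg₂ : ∀ t, HasDerivAt g₂ (g₃ t) t)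
    (hb : ∀ t ∈ Set.Icc (0 : ℝ) 1, |g₃ t| ≤ M) (hs : s ∈ Set.Icc (0 : ℝ) 1)
    (ht : t ∈ Set.Icc (0 : ℝ) 1) {r : ℝ} (hr : r ∈ Set.uIcc s t) :
    |(∫ r in s..t, g r) / (t - s) - (t - s) ^ 2 / 6 * g₂ r - (g s + g₁ s * (t - s) / 2)|
      ≤ 2 * M * |t - s| ^ 3 := by
  have hc : Continuous g := continuous_iff_continuousAt.2 fun t => (hg t).continuousAt
  have h := abs_taylor_four_le hM (hasDerivAt_integral_left_fixed hc s) hg hg₁ hg₂ hb hs ht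
  have hp : 0 < |t - s| := abs_pos.2 (sub_ne_zero.2 hst.symm)
  have hr' : |g₂ r - g₂ s| ≤ M * |t - s| :=
    (abs_sub_le_of_deriv hM hg₂ hb hs (Set.uIcc_subset_Icc hs ht hr)).trans
      (mul_le_mul_of_nonneg_left (Set.abs_sub_left_of_mem_uIcc hr) hM)
  have h1 : |(∫ r in s..t, g r) / (t - s) - g s - g₁ s * (t - s) / 2 - g₂ s * (t - s) ^ 2 / 6|
      ≤ M * |t - s| ^ 3 := by
    refine le_of_mul_le_mul_right ?_ hp
    rw [← abs_mul]
    refine le_trans (le_of_eq ?_) (h.trans (le_of_eq (by ring)))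
    congr 1
    have := sub_ne_zero.2 hst.symm
    simp only [intervalIntegral.integral_same, sub_zero]
    field_simp
  have h2 : |(t - s) ^ 2 / 6 * (g₂ r - g₂ s)| ≤ M * |t - s| ^ 3 := by
    rw [abs_mul, abs_div, abs_pow]
    calc _ ≤ |t - s| ^ 2 / |6| * (M * |t - s|) := by gcongr
      _ ≤ |t - s| ^ 2 * (M * |t - s|) := by
          gcongr
          rw [abs_of_pos (by norm_num : (0 : ℝ) < 6)]
          exact div_le_self (by positivity) (by norm_num)
      _ = _ := by ring
  have h3 := abs_sub _ _ |>.trans (add_le_add h1 h2)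
  refine le_trans (le_of_eq ?_) (h3.trans (le_of_eq (by ring)))
  congr 1
  ring

/-- The midpoint rule is second-order accurate. -/
lemma abs_average_sub_midpoint_le (hM : 0 ≤ M) (hst : s < t) (hg : ∀ t, HasDerivAt g (g₁ t) t)
    (hg₁ : ∀ t, HasDerivAt g₁ (g₂ t) t)
    (hb : ∀ t ∈ Set.Icc (0 : ℝ) 1, |g₂ t| ≤ M) (hs : s ∈ Set.Icc (0 : ℝ) 1)
    (ht : t ∈ Set.Icc (0 : ℝ) 1) :
    |(∫ r in s..t, g r) / (t - s) - g ((s + t) / 2)| ≤ M * (t - s) ^ 2 := by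
  have hc : Continuous g := continuous_iff_continuousAt.2 fun t => (hg t).continuousAt
  have hm : (s + t) / 2 ∈ Set.Icc (0 : ℝ) 1 := ⟨by linarith [hs.1, ht.1], by linarith [hs.2, ht.2]⟩
  have h1 := abs_taylor_three_le hM (hasDerivAt_integral_left_fixed hc ((s + t) / 2)) hg hg₁ hb hm ht
  have h2 := abs_taylor_three_le hM (hasDerivAt_integral_left_fixed hc ((s + t) / 2)) hg hg₁ hb hm hs
  have hd : 0 < t - s := sub_pos.2 hst
  have e1 : t - (s + t) / 2 = (t - s) / 2 := by ring
  have e2 : s - (s + t) / 2 = -((t - s) / 2) := by ring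
  have hi := intervalIntegral.integral_interval_sub_left
    (hc.intervalIntegrable (μ := MeasureTheory.volume) ((s + t) / 2) t)
    (hc.intervalIntegrable ((s + t) / 2) s)
  rw [e1, abs_of_pos (half_pos hd)] at h1
  rw [e2, abs_neg, abs_of_pos (half_pos hd)] at h2
  simp only [intervalIntegral.integral_same, sub_zero] at h1 h2
  rw [← hi, ← mul_le_mul_iff_of_pos_right hd, ← abs_of_pos hd, ← abs_mul, abs_of_pos hd, sub_mul,
    div_mul_cancel₀ _ hd.ne']
  have h3 : 0 ≤ M * (t - s) ^ 3 := by positivity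
  rw [abs_le] at *
  constructor <;> nlinarith [h1.1, h1.2, h2.1, h2.2]

end Taylor

/-! ### Functions with bounded derivatives on the unit square -/

section CkBound

/-- `f` is `Cⁿ` on the plane and its derivatives of order at most `n` are bounded by `M` on the
unit square. -/
def HasCkBound (n : ℕ) (f : ℝ × ℝ → ℝ) (M : ℝ) : Prop :=
  ContDiff ℝ n f ∧ ∀ p ∈ Set.Icc ((0 : ℝ), (0 : ℝ)) ((1 : ℝ), (1 : ℝ)), ∀ m ≤ n,
    ‖iteratedFDeriv ℝ m f p‖ ≤ M

variable {f g : ℝ × ℝ → ℝ} {n : ℕ} {M M' : ℝ}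

lemma mk_mem_unitSquare {a b : ℝ} (ha : a ∈ Set.Icc (0 : ℝ) 1) (hb : b ∈ Set.Icc (0 : ℝ) 1) :
    (a, b) ∈ Set.Icc ((0 : ℝ), (0 : ℝ)) ((1 : ℝ), (1 : ℝ)) :=
  ⟨⟨ha.1, hb.1⟩, ⟨ha.2, hb.2⟩⟩

lemma pdx_eq_fderiv (hf : Differentiable ℝ f) : pdx f = fun p => fderiv ℝ f p (1, 0) := by
  funext p
  have h : HasDerivAt (fun t : ℝ => (t, p.2)) ((1 : ℝ), (0 : ℝ)) p.1 :=
    (hasDerivAt_id p.1).prodMk (hasDerivAt_const _ _)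
  exact ((hf (p.1, p.2)).hasFDerivAt.comp_hasDerivAt p.1 h).deriv

lemma pdy_eq_fderiv (hf : Differentiable ℝ f) : pdy f = fun p => fderiv ℝ f p (0, 1) := by
  funext p
  have h : HasDerivAt (fun t : ℝ => (p.1, t)) ((0 : ℝ), (1 : ℝ)) p.2 :=
    (hasDerivAt_const _ _).prodMk (hasDerivAt_id p.2)
  exact ((hf (p.1, p.2)).hasFDerivAt.comp_hasDerivAt p.2 h).deriv

lemma hasDerivAt_pdx (hf : Differentiable ℝ f) (t b : ℝ) :
    HasDerivAt (fun t => f (t, b)) (pdx f (t, b)) t :=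
  DifferentiableAt.hasDerivAt (by fun_prop)

lemma hasDerivAt_pdy (hf : Differentiable ℝ f) (a t : ℝ) :
    HasDerivAt (fun t => f (a, t)) (pdy f (a, t)) t :=
  DifferentiableAt.hasDerivAt (by fun_prop)

lemma HasCkBound.differentiable (hf : HasCkBound (n + 1) f M) : Differentiable ℝ f :=
  hf.1.differentiable (by simp)

lemma HasCkBound.continuous (hf : HasCkBound n f M) : Continuous f := hf.1.continuous

lemma HasCkBound.abs_le (hf : HasCkBound n f M) {a b : ℝ} (ha : a ∈ Set.Icc (0 : ℝ) 1)
    (hb : b ∈ Set.Icc (0 : ℝ) 1) : |f (a, b)| ≤ M := by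
  have := hf.2 (a, b) (mk_mem_unitSquare ha hb) 0 (Nat.zero_le n)
  rwa [norm_iteratedFDeriv_zero] at this

lemma HasCkBound.nonneg (hf : HasCkBound n f M) : 0 ≤ M :=
  (norm_nonneg _).trans (hf.2 (0, 0) (mk_mem_unitSquare (by simp) (by simp)) 0 (Nat.zero_le n))

lemma HasCkBound.mono (hf : HasCkBound n f M) (h : M ≤ M') : HasCkBound n f M' :=
  ⟨hf.1, fun p hp m hm => (hf.2 p hp m hm).trans h⟩

lemma HasCkBound.of_succ (hf : HasCkBound (n + 1) f M) : HasCkBound n f M :=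
  ⟨hf.1.of_le (by simp), fun p hp m hm => hf.2 p hp m (by omega)⟩

lemma HasCkBound.fderiv_apply (hf : HasCkBound (n + 1) f M) {v : ℝ × ℝ} (hv : ‖v‖ ≤ 1) :
    HasCkBound n (fun p => fderiv ℝ f p v) M := by
  have h1 : ContDiff ℝ n (fderiv ℝ f) := hf.1.fderiv_right (by simp)
  refine ⟨h1.clm_apply contDiff_const, fun p hp m hm => ?_⟩
  have h2 := norm_iteratedFDeriv_clm_apply_const (c := v) (h1.contDiffAt (x := p)) (n := m)
    (by exact_mod_cast hm)
  rw [norm_iteratedFDeriv_fderiv] at h2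
  refine h2.trans ((mul_le_of_le_one_left (norm_nonneg _) hv).trans (hf.2 p hp (m + 1) (by omega)))

lemma HasCkBound.pdx (hf : HasCkBound (n + 1) f M) : HasCkBound n (pdx f) M := by
  rw [pdx_eq_fderiv hf.differentiable]
  exact hf.fderiv_apply (by simp [Prod.norm_def])

lemma HasCkBound.pdy (hf : HasCkBound (n + 1) f M) : HasCkBound n (pdy f) M := by
  rw [pdy_eq_fderiv hf.differentiable]
  exact hf.fderiv_apply (by simp [Prod.norm_def])

lemma HasCkBound.add (hf : HasCkBound n f M) (hg : HasCkBound n g M') :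
    HasCkBound n (fun p => f p + g p) (M + M') := by
  refine ⟨hf.1.add hg.1, fun p hp m hm => ?_⟩
  have hm' : (m : WithTop ℕ∞) ≤ n := by exact_mod_cast hm
  have := iteratedFDeriv_add_apply (x := p) (hf.1.of_le hm').contDiffAt (hg.1.of_le hm').contDiffAt
  change ‖iteratedFDeriv ℝ m (f + g) p‖ ≤ _
  rw [this]
  exact (norm_add_le _ _).trans (add_le_add (hf.2 p hp m hm) (hg.2 p hp m hm))

lemma HasCkBound.const_mul (hf : HasCkBound n f M) (c : ℝ) :
    HasCkBound n (fun p => c * f p) (|c| * M) := by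
  refine ⟨contDiff_const.mul hf.1, fun p hp m hm => ?_⟩
  have hm' : (m : WithTop ℕ∞) ≤ n := by exact_mod_cast hm
  have := iteratedFDeriv_const_smul_apply (a := c) (x := p) (hf.1.of_le hm').contDiffAt
  change ‖iteratedFDeriv ℝ m (c • f) p‖ ≤ _
  rw [this, norm_smul, Real.norm_eq_abs]
  exact mul_le_mul_of_nonneg_left (hf.2 p hp m hm) (abs_nonneg c)

lemma HasCkBound.swap (hf : HasCkBound n f M) : HasCkBound n (f ∘ Prod.swap) M := by
  have h := LinearIsometryEquiv.norm_iteratedFDeriv_comp_right (𝕜 := ℝ)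
    (LinearIsometryEquiv.prodComm ℝ ℝ ℝ) f
  refine ⟨hf.1.comp (contDiff_snd.prodMk contDiff_fst), fun p hp m hm => ?_⟩
  exact (h p m).trans_le (hf.2 p.swap ⟨⟨hp.1.2, hp.1.1⟩, ⟨hp.2.2, hp.2.1⟩⟩ m hm)

lemma pdx_pdy_comm (hf : ContDiff ℝ 2 f) : pdx (pdy f) = pdy (pdx f) := by
  have hd : Differentiable ℝ f := hf.differentiable (by simp)
  have h1 : Differentiable ℝ (fderiv ℝ f) :=
    (hf.fderiv_right (m := 1) (by norm_num)).differentiable (by simp)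
  rw [pdx_eq_fderiv hd, pdy_eq_fderiv hd, pdx_eq_fderiv (by fun_prop), pdy_eq_fderiv (by fun_prop)]
  funext p
  rw [fderiv_clm_apply (by fun_prop) (by fun_prop), fderiv_clm_apply (by fun_prop) (by fun_prop)]
  simpa using (hf.contDiffAt (x := p)).isSymmSndFDerivAt (by simp) (1, 0) (0, 1)

lemma hasCkBound_norm3 (hf : ContDiff ℝ 3 f) : HasCkBound 3 f (norm3 f) := by
  refine ⟨hf, fun p hp m hm => ?_⟩
  have hle : ∀ q : ℝ × ℝ, ∀ k : Fin 4, ‖iteratedFDeriv ℝ (k : ℕ) f q‖ ≤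
      ⨆ k : Fin 4, ‖iteratedFDeriv ℝ (k : ℕ) f q‖ := fun q k =>
    le_ciSup (f := fun k : Fin 4 => ‖iteratedFDeriv ℝ (k : ℕ) f q‖) (Set.finite_range _).bddAbove k
  have hbdd : BddAbove (Set.range fun p : Set.Icc ((0 : ℝ), (0 : ℝ)) ((1 : ℝ), (1 : ℝ)) =>
      ⨆ k : Fin 4, ‖iteratedFDeriv ℝ (k : ℕ) f (p : ℝ × ℝ)‖) := by
    have hk : ∀ k : Fin 4, ∃ B, ∀ q ∈ Set.Icc ((0 : ℝ), (0 : ℝ)) ((1 : ℝ), (1 : ℝ)),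
        ‖iteratedFDeriv ℝ (k : ℕ) f q‖ ≤ B := fun k =>
      isCompact_Icc.exists_bound_of_continuousOn
        (hf.continuous_iteratedFDeriv (by exact_mod_cast Nat.lt_succ_iff.1 k.2)).continuousOn
    choose B hB using hk
    refine ⟨⨆ k, B k, ?_⟩
    rintro _ ⟨q, rfl⟩
    exact ciSup_mono (Set.finite_range _).bddAbove fun k => hB k q q.2
  exact (hle p ⟨m, by omega⟩).trans (le_ciSup hbdd ⟨p, hp⟩)

end CkBound

/-! ### The interpolant

The displacement is interpolated so that its discrete divergence is a linear reconstruction of the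
exact divergence, while its shear difference quotients are second-order accurate at the nodes of an
arbitrary grid. -/

section Interpolant

/-- A smooth step from `0` to `1` on the unit interval with vanishing end slopes. -/
def smoothStep (t : ℝ) : ℝ := 3 * t ^ 2 - 2 * t ^ 3

/-- The mean value of `g` over the `j`-th cell. -/
def cellAvg (y : ℕ → ℝ) (g : ℝ → ℝ) (j : ℕ) : ℝ := (∫ t in y j..y (j + 1), g t) / hMid y j

/-- The mean-preserving correction `-l_{j+1/2}² G_j / 6` of cell values. -/
def cellCorr (y : ℕ → ℝ) (n : ℕ) (G : ℕ → ℝ) (j : ℕ) : ℝ :=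
  (smoothStep (y (j + 1)) - smoothStep (y j)) / hMid y j * ∑ k ∈ range n, hMid y k ^ 3 / 6 * G k
    - hMid y j ^ 2 / 6 * G j

/-- The discrete primitive of `cellCorr`. -/
def nodeCorr (x : ℕ → ℝ) (n : ℕ) (G : ℕ → ℝ) (i : ℕ) : ℝ :=
  ∑ k ∈ range n, hMid x k ^ 3 / 6 * (smoothStep (x i) - if k < i then 1 else 0) * G k

variable {x y : ℕ → ℝ} {n nx ny : ℕ} {M : ℝ}

lemma smoothStep_mem_Icc {t : ℝ} (ht : t ∈ Set.Icc (0 : ℝ) 1) :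
    smoothStep t ∈ Set.Icc (0 : ℝ) 1 := by
  obtain ⟨h0, h1⟩ := ht
  unfold smoothStep
  constructor
  · nlinarith [mul_nonneg (sq_nonneg t) (by linarith : 0 ≤ 3 - 2 * t)]
  · nlinarith [mul_nonneg (sq_nonneg (1 - t)) (by linarith : 0 ≤ 1 + 2 * t)]

lemma abs_slope_smoothStep_sub_le {s t : ℝ} (hs : s ∈ Set.Icc (0 : ℝ) 1)
    (ht : t ∈ Set.Icc (0 : ℝ) 1) (hst : s ≠ t) :
    |(smoothStep t - smoothStep s) / (t - s) - 6 * s * (1 - s)| ≤ 3 * |t - s| := by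
  have h : (smoothStep t - smoothStep s) / (t - s) - 6 * s * (1 - s) =
      (3 - 2 * t - 4 * s) * (t - s) := by
    have := sub_ne_zero.2 hst.symm
    unfold smoothStep
    field_simp
    ring
  rw [h, abs_mul]
  gcongr
  rw [abs_le]
  constructor <;> linarith [hs.1, hs.2, ht.1, ht.2]

lemma IsGrid.abs_slope_smoothStep_le (hy : IsGrid y n) {j : ℕ} (hj : j < n) :
    |(smoothStep (y (j + 1)) - smoothStep (y j)) / hMid y j| ≤ 6 := by
  have hl := hy.hMid_pos hj
  have hs := hy.mem_Icc hj.le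
  have ht := hy.mem_Icc (i := j + 1) hj
  have h : (smoothStep (y (j + 1)) - smoothStep (y j)) / hMid y j =
      3 * (y (j + 1) + y j) - 2 * (y (j + 1) ^ 2 + y (j + 1) * y j + y j ^ 2) := by
    rw [div_eq_iff hl.ne']
    unfold smoothStep hMid
    ring
  rw [h, abs_le]
  constructor <;> nlinarith [hs.1, hs.2, ht.1, ht.2, mul_nonneg hs.1 ht.1]

lemma IsGrid.abs_sum_cube_mul_le (hy : IsGrid y n) {c G : ℕ → ℝ} (hM : 0 ≤ M)
    (hc : ∀ k < n, |c k| ≤ 1) (hG : ∀ k < n, |G k| ≤ M) :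
    |∑ k ∈ range n, hMid y k ^ 3 / 6 * c k * G k| ≤ hmax y n ^ 2 / 6 * M := by
  calc |∑ k ∈ range n, hMid y k ^ 3 / 6 * c k * G k|
      ≤ ∑ k ∈ range n, |hMid y k ^ 3 / 6 * c k * G k| := abs_sum_le_sum_abs _ _
    _ ≤ ∑ k ∈ range n, hMid y k ^ 3 / 6 * 1 * M := by
        refine sum_le_sum fun k hk => ?_
        rw [mem_range] at hk
        have hp := hy.hMid_pos hk
        rw [abs_mul, abs_mul, abs_of_pos (by positivity : 0 < hMid y k ^ 3 / 6)]
        have := hc k hk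
        have := hG k hk
        gcongr
    _ = (∑ k ∈ range n, hMid y k ^ 3) / 6 * M := by rw [sum_div, sum_mul]; simp
    _ ≤ _ := by
        gcongr
        exact hy.sum_hMid_cube_le

lemma IsGrid.abs_sum_cube_mul_le' (hy : IsGrid y n) {G : ℕ → ℝ} (hM : 0 ≤ M)
    (hG : ∀ k < n, |G k| ≤ M) :
    |∑ k ∈ range n, hMid y k ^ 3 / 6 * G k| ≤ hmax y n ^ 2 / 6 * M := by
  simpa using hy.abs_sum_cube_mul_le (c := fun _ => 1) hM (by simp) hG

lemma IsGrid.abs_cellCorr_le (hy : IsGrid y n) {G : ℕ → ℝ} (hM : 0 ≤ M)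
    (hG : ∀ k < n, |G k| ≤ M) {j : ℕ} (hj : j < n) :
    |cellCorr y n G j| ≤ 2 * hmax y n ^ 2 * M := by
  have h1 := mul_le_mul (hy.abs_slope_smoothStep_le hj) (hy.abs_sum_cube_mul_le' hM hG)
    (abs_nonneg _) (by norm_num)
  have h2 : |hMid y j ^ 2 / 6 * G j| ≤ hmax y n ^ 2 * M := by
    rw [abs_mul, abs_of_nonneg (by positivity)]
    refine mul_le_mul ?_ (hG j hj) (abs_nonneg _) (sq_nonneg _)
    linarith [hy.hMid_sq_le hj, sq_nonneg (hMid y j)]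
  rw [← abs_mul] at h1
  unfold cellCorr
  refine (abs_sub _ _).trans ((add_le_add h1 h2).trans (le_of_eq (by ring)))

lemma IsGrid.abs_nodeCorr_le (hx : IsGrid x n) {G : ℕ → ℝ} (hM : 0 ≤ M)
    (hG : ∀ k < n, |G k| ≤ M) {i : ℕ} (hi : i ≤ n) :
    |nodeCorr x n G i| ≤ hmax x n ^ 2 * M := by
  have h := hx.abs_sum_cube_mul_le (c := fun k => smoothStep (x i) - if k < i then 1 else 0) hM
    (fun k _ => ?_) hG
  · unfold nodeCorr
    refine h.trans ?_
    gcongr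
    linarith [sq_nonneg (hmax x n)]
  · have := smoothStep_mem_Icc (hx.mem_Icc hi)
    rw [abs_le]
    split_ifs <;> constructor <;> linarith [this.1, this.2]

lemma IsGrid.nodeCorr_zero (hx : IsGrid x n) (G : ℕ → ℝ) : nodeCorr x n G 0 = 0 := by
  simp [nodeCorr, smoothStep, hx.1]

lemma IsGrid.nodeCorr_self (hx : IsGrid x n) (G : ℕ → ℝ) : nodeCorr x n G n = 0 := by
  refine sum_eq_zero fun k hk => ?_
  rw [if_pos (mem_range.1 hk), hx.2.1]
  norm_num [smoothStep]

lemma nodeCorr_eq_zero {G : ℕ → ℝ} (hG : ∀ k < n, G k = 0) (i : ℕ) : nodeCorr x n G i = 0 :=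
  sum_eq_zero fun k hk => by rw [hG k (mem_range.1 hk), mul_zero]

lemma nodeCorr_sub (G G' : ℕ → ℝ) (i : ℕ) :
    nodeCorr x n (fun k => G k - G' k) i = nodeCorr x n G i - nodeCorr x n G' i := by
  simp [nodeCorr, mul_sub, sum_sub_distrib]

lemma cellCorr_eq_zero {G : ℕ → ℝ} (hG : ∀ k < n, G k = 0) {j : ℕ} (hj : j < n) :
    cellCorr y n G j = 0 := by
  rw [cellCorr, hG j hj, sum_eq_zero fun k hk => by rw [hG k (mem_range.1 hk), mul_zero]]
  simp

lemma cellCorr_add (G G' : ℕ → ℝ) (j : ℕ) :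
    cellCorr y n (fun k => G k + G' k) j = cellCorr y n G j + cellCorr y n G' j := by
  simp only [cellCorr, mul_add, sum_add_distrib]
  ring

lemma cellCorr_sub_div (G G' : ℕ → ℝ) (c : ℝ) (j : ℕ) :
    cellCorr y n (fun k => (G k - G' k) / c) j = (cellCorr y n G j - cellCorr y n G' j) / c := by
  simp only [cellCorr, ← mul_div_assoc, mul_sub, sum_sub_distrib, ← sum_div]
  ring

lemma IsGrid.nodeCorr_succ_sub (hx : IsGrid x n) (G : ℕ → ℝ) {i : ℕ} (hi : i < n) :
    (nodeCorr x n G (i + 1) - nodeCorr x n G i) / hMid x i = cellCorr x n G i := by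
  have hp := (hx.hMid_pos hi).ne'
  have h : nodeCorr x n G (i + 1) - nodeCorr x n G i =
      (smoothStep (x (i + 1)) - smoothStep (x i)) * ∑ k ∈ range n, hMid x k ^ 3 / 6 * G k
        - hMid x i ^ 3 / 6 * G i := by
    have hsum : ∑ k ∈ range n, (if k = i then hMid x k ^ 3 / 6 * G k else 0) =
        hMid x i ^ 3 / 6 * G i := by
      rw [sum_ite_eq' (range n) i, if_pos (mem_range.2 hi)]
    rw [← hsum, mul_sum, nodeCorr, nodeCorr, ← sum_sub_distrib, ← sum_sub_distrib]
    refine sum_congr rfl fun k _ => ?_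
    rcases lt_trichotomy k i with hk | rfl | hk
    · rw [if_pos (by omega), if_pos hk, if_neg hk.ne]
      ring
    · rw [if_pos (by omega), if_neg (lt_irrefl k), if_pos rfl]
      ring
    · rw [if_neg (by omega), if_neg (by omega), if_neg hk.ne']
      ring
  rw [h, cellCorr]
  field_simp

lemma cellAvg_eq_zero (hy : IsGrid y n) {g : ℝ → ℝ} (hg : ∀ t ∈ Set.Icc (0 : ℝ) 1, g t = 0)
    {j : ℕ} (hj : j < n) : cellAvg y g j = 0 := by
  rw [cellAvg, intervalIntegral.integral_congr (g := fun _ => 0) fun t ht => ?_]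
  · simp
  · exact hg t (Set.uIcc_subset_Icc (hy.mem_Icc hj.le) (hy.mem_Icc hj) ht)

lemma IsGrid.abs_cellAvg_le (hy : IsGrid y n) {g : ℝ → ℝ}
    (hg : ∀ t ∈ Set.Icc (0 : ℝ) 1, |g t| ≤ M) {j : ℕ} (hj : j < n) : |cellAvg y g j| ≤ M := by
  have hp := hy.hMid_pos hj
  have h := intervalIntegral.norm_integral_le_of_norm_le_const (f := g) (a := y j) (b := y (j + 1))
    (C := M) fun t ht => hg t (Set.uIcc_subset_Icc (hy.mem_Icc hj.le) (hy.mem_Icc hj)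
      (Set.uIoc_subset_uIcc ht))
  change _ ≤ M * |hMid y j| at h
  rw [cellAvg, abs_div, div_le_iff₀ (abs_pos.2 hp.ne')]
  exact h

lemma cellAvg_add {g g' : ℝ → ℝ} (hg : Continuous g) (hg' : Continuous g') (j : ℕ) :
    cellAvg y (fun t => g t + g' t) j = cellAvg y g j + cellAvg y g' j := by
  rw [cellAvg, intervalIntegral.integral_add (hg.intervalIntegrable _ _)
    (hg'.intervalIntegrable _ _), add_div, cellAvg, cellAvg]

lemma cellAvg_sub {g g' : ℝ → ℝ} (hg : Continuous g) (hg' : Continuous g') (j : ℕ) :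
    cellAvg y (fun t => g t - g' t) j = cellAvg y g j - cellAvg y g' j := by
  rw [cellAvg, intervalIntegral.integral_sub (hg.intervalIntegrable _ _)
    (hg'.intervalIntegrable _ _), sub_div, cellAvg, cellAvg]

lemma cellAvg_div (g : ℝ → ℝ) (c : ℝ) (j : ℕ) :
    cellAvg y (fun t => g t / c) j = cellAvg y g j / c := by
  rw [cellAvg, intervalIntegral.integral_div, cellAvg, div_right_comm]

lemma cellAvg_deriv {g g' : ℝ → ℝ} (hg : ∀ t, HasDerivAt g (g' t) t) (hg' : Continuous g')
    (j : ℕ) : cellAvg y g' j = (g (y (j + 1)) - g (y j)) / hMid y j := by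
  rw [cellAvg, intervalIntegral.integral_eq_sub_of_hasDerivAt (fun t _ => hg t)
    (hg'.intervalIntegrable _ _)]

/-- The interpolant of `f` at the midpoints of the vertical edges. -/
def edgeInterp (x y : ℕ → ℝ) (nx ny : ℕ) (f : ℝ × ℝ → ℝ) (i j : ℕ) : ℝ :=
  cellAvg y (fun t => f (x i, t)) j + cellCorr y ny (fun k => pdy (pdy f) (x i, midpt y k)) j
    + nodeCorr x nx (fun k => cellAvg y (fun t => pdx (pdx (pdx f)) (midpt x k, t)) j) i

/-- The cell-centered reconstruction of `φ` for which `edgeInterp` commutes with `∂_x`. -/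
def cellRecon (x y : ℕ → ℝ) (nx ny : ℕ) (φ : ℝ × ℝ → ℝ) (i j : ℕ) : ℝ :=
  cellAvg y (fun t => cellAvg x (fun s => φ (s, t)) i) j
    + cellCorr y ny (fun k => cellAvg x (fun s => pdy (pdy φ) (s, midpt y k)) i) j
    + cellCorr x nx (fun k => cellAvg y (fun t => pdx (pdx φ) (midpt x k, t)) j) i

variable {f φ ψ : ℝ × ℝ → ℝ}

lemma pdx_eq_zero_of_Ioo {b : ℝ} (hf : ∀ t ∈ Set.Ioo (0 : ℝ) 1, f (t, b) = 0) :
    ∀ t ∈ Set.Ioo (0 : ℝ) 1, pdx f (t, b) = 0 := by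
  intro t ht
  have h : (fun t => f (t, b)) =ᶠ[nhds t] fun _ => 0 :=
    Filter.eventuallyEq_of_mem (isOpen_Ioo.mem_nhds ht) hf
  exact h.deriv_eq.trans (deriv_const t 0)

lemma pdy_eq_zero_of_Ioo {a : ℝ} (hf : ∀ t ∈ Set.Ioo (0 : ℝ) 1, f (a, t) = 0) :
    ∀ t ∈ Set.Ioo (0 : ℝ) 1, pdy f (a, t) = 0 := by
  intro t ht
  have h : (fun t => f (a, t)) =ᶠ[nhds t] fun _ => 0 :=
    Filter.eventuallyEq_of_mem (isOpen_Ioo.mem_nhds ht) hf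
  exact h.deriv_eq.trans (deriv_const t 0)

lemma edgeInterp_eq_zero (hx : IsGrid x nx) (hy : IsGrid y ny) {i : ℕ} (hi : i = 0 ∨ i = nx)
    (hf : ∀ t ∈ Set.Icc (0 : ℝ) 1, f (x i, t) = 0) {j : ℕ} (hj : j < ny) :
    edgeInterp x y nx ny f i j = 0 := by
  have h2 := pdy_eq_zero_of_Ioo (pdy_eq_zero_of_Ioo fun t ht => hf t (Set.Ioo_subset_Icc_self ht))
  rw [edgeInterp, cellAvg_eq_zero hy hf hj,
    cellCorr_eq_zero (fun k hk => h2 _ (hy.midpt_mem_Ioo hk)) hj]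
  rcases hi with rfl | rfl
  · simp [hx.nodeCorr_zero]
  · simp [hx.nodeCorr_self]

lemma edgeInterp_succ_sub (hx : IsGrid x nx) (hf : ContDiff ℝ 3 f)
    {i j : ℕ} (hi : i < nx) :
    (edgeInterp x y nx ny f (i + 1) j - edgeInterp x y nx ny f i j) / hMid x i =
      cellRecon x y nx ny (pdx f) i j := by
  have hb : HasCkBound 3 f (norm3 f) := hasCkBound_norm3 hf
  have hcomm : pdy (pdy (pdx f)) = pdx (pdy (pdy f)) := by
    rw [← pdx_pdy_comm (hf.of_le (by norm_num)), ← pdx_pdy_comm hb.pdy.1]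
  have hc1 := hb.pdx.continuous
  have hc2 := hb.pdy.pdy.pdx.continuous
  have hd2 := hb.pdy.pdy.differentiable
  have hc := hf.continuous
  have h1 : (fun t => cellAvg x (fun s => pdx f (s, t)) i) =
      fun t => (f (x (i + 1), t) - f (x i, t)) / hMid x i := by
    funext t
    exact cellAvg_deriv (fun s => hasDerivAt_pdx hb.differentiable s t) (by fun_prop) i
  have h2 : (fun k => cellAvg x (fun s => pdx (pdy (pdy f)) (s, midpt y k)) i) =
      fun k => (pdy (pdy f) (x (i + 1), midpt y k) - pdy (pdy f) (x i, midpt y k)) / hMid x i := by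
    funext k
    exact cellAvg_deriv (fun s => hasDerivAt_pdx hd2 s _) (by fun_prop) i
  rw [cellRecon, hcomm, h1, h2, cellCorr_sub_div, cellAvg_div,
    cellAvg_sub (by fun_prop) (by fun_prop), ← hx.nodeCorr_succ_sub _ hi]
  unfold edgeInterp
  ring

lemma cellRecon_swap (hφ : Continuous φ) (i j : ℕ) :
    cellRecon y x ny nx (φ ∘ Prod.swap) j i = cellRecon x y nx ny φ i j := by
  have h : cellAvg x (fun s => cellAvg y (fun t => φ (s, t)) j) i =
      cellAvg y (fun t => cellAvg x (fun s => φ (s, t)) i) j := by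
    simp only [cellAvg, intervalIntegral.integral_div]
    rw [MeasureTheory.intervalIntegral_intervalIntegral_swap, div_right_comm]
    exact (hφ.continuousOn.integrableOn_compact
      (isCompact_uIcc.prod isCompact_uIcc)).mono_set
        (Set.prod_mono Set.uIoc_subset_uIcc Set.uIoc_subset_uIcc)
  rw [cellRecon, cellRecon, ← h, add_right_comm]
  rfl

lemma cellRecon_add (hφ : HasCkBound 2 φ M) {M' : ℝ} (hψ : HasCkBound 2 ψ M') (i j : ℕ) :
    cellRecon x y nx ny (fun p => φ p + ψ p) i j =
      cellRecon x y nx ny φ i j + cellRecon x y nx ny ψ i j := by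
  have hx1 : ∀ {φ ψ : ℝ × ℝ → ℝ}, Differentiable ℝ φ → Differentiable ℝ ψ →
      pdx (fun p => φ p + ψ p) = fun p => pdx φ p + pdx ψ p := fun h h' =>
    funext fun p => ((hasDerivAt_pdx h p.1 p.2).fun_add (hasDerivAt_pdx h' p.1 p.2)).deriv
  have hy1 : ∀ {φ ψ : ℝ × ℝ → ℝ}, Differentiable ℝ φ → Differentiable ℝ ψ →
      pdy (fun p => φ p + ψ p) = fun p => pdy φ p + pdy ψ p := fun h h' =>
    funext fun p => ((hasDerivAt_pdy h p.1 p.2).fun_add (hasDerivAt_pdy h' p.1 p.2)).deriv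
  have c1 := hφ.continuous
  have c2 := hψ.continuous
  have c3 := hφ.pdx.pdx.continuous
  have c4 := hψ.pdx.pdx.continuous
  have c5 := hφ.pdy.pdy.continuous
  have c6 := hψ.pdy.pdy.continuous
  have hcont : ∀ {φ : ℝ × ℝ → ℝ}, Continuous φ →
      Continuous fun t => cellAvg x (fun s => φ (s, t)) i := fun h =>
    (intervalIntegral.continuous_parametric_intervalIntegral_of_continuous' (by fun_prop) _ _
      ).div_const _
  have e1 : (fun t => cellAvg x (fun s => φ (s, t) + ψ (s, t)) i) = fun t =>
      cellAvg x (fun s => φ (s, t)) i + cellAvg x (fun s => ψ (s, t)) i :=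
    funext fun t => cellAvg_add (by fun_prop) (by fun_prop) i
  have e2 : (fun k => cellAvg x (fun s => pdy (pdy φ) (s, midpt y k)
      + pdy (pdy ψ) (s, midpt y k)) i) = fun k =>
      cellAvg x (fun s => pdy (pdy φ) (s, midpt y k)) i
        + cellAvg x (fun s => pdy (pdy ψ) (s, midpt y k)) i :=
    funext fun t => cellAvg_add (by fun_prop) (by fun_prop) i
  have e3 : (fun k => cellAvg y (fun t => pdx (pdx φ) (midpt x k, t)
      + pdx (pdx ψ) (midpt x k, t)) j) = fun k =>
      cellAvg y (fun t => pdx (pdx φ) (midpt x k, t)) j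
        + cellAvg y (fun t => pdx (pdx ψ) (midpt x k, t)) j :=
    funext fun t => cellAvg_add (by fun_prop) (by fun_prop) j
  rw [cellRecon, hx1 hφ.differentiable hψ.differentiable,
    hx1 hφ.pdx.differentiable hψ.pdx.differentiable,
    hy1 hφ.differentiable hψ.differentiable, hy1 hφ.pdy.differentiable hψ.pdy.differentiable,
    e1, e2, e3, cellAvg_add (hcont c1) (hcont c2), cellCorr_add, cellCorr_add, cellRecon, cellRecon]
  ring

lemma abs_cellRecon_sub_le (hx : IsGrid x nx) (hy : IsGrid y ny) (hφ : HasCkBound 2 φ M)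
    {i j : ℕ} (hi : i < nx) (hj : j < ny) :
    |cellRecon x y nx ny φ i j - φ (midpt x i, midpt y j)| ≤
      3 * (hmax x nx ^ 2 + hmax y ny ^ 2) * M := by
  have hM := hφ.nonneg
  have c1 := hφ.continuous
  have hcont : Continuous fun t => cellAvg x (fun s => φ (s, t)) i :=
    (intervalIntegral.continuous_parametric_intervalIntegral_of_continuous' (by fun_prop) _ _
      ).div_const _
  have h1 : |cellAvg y (fun t => cellAvg x (fun s => φ (s, t)) i - φ (midpt x i, t)) j| ≤
      hmax x nx ^ 2 * M := by
    refine hy.abs_cellAvg_le (fun t ht => ?_) hj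
    have := abs_average_sub_midpoint_le hM (hx.2.2 i hi)
      (fun s => hasDerivAt_pdx hφ.differentiable s t)
      (fun s => hasDerivAt_pdx hφ.pdx.differentiable s t)
      (fun s hs => hφ.pdx.pdx.abs_le hs ht) (hx.mem_Icc hi.le) (hx.mem_Icc hi)
    refine this.trans ?_
    rw [mul_comm]
    exact mul_le_mul_of_nonneg_right (hx.hMid_sq_le hi) hM
  have h2 : |cellAvg y (fun t => φ (midpt x i, t)) j - φ (midpt x i, midpt y j)| ≤
      hmax y ny ^ 2 * M := by
    have := abs_average_sub_midpoint_le hM (hy.2.2 j hj)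
      (fun s => hasDerivAt_pdy hφ.differentiable (midpt x i) s)
      (fun s => hasDerivAt_pdy hφ.pdy.differentiable (midpt x i) s)
      (fun s hs => hφ.pdy.pdy.abs_le (hx.midpt_mem_Icc hi) hs) (hy.mem_Icc hj.le) (hy.mem_Icc hj)
    refine this.trans ?_
    rw [mul_comm]
    exact mul_le_mul_of_nonneg_right (hy.hMid_sq_le hj) hM
  have h3 := hy.abs_cellCorr_le (G := fun k => cellAvg x (fun s => pdy (pdy φ) (s, midpt y k)) i)
    hM (fun k hk => hx.abs_cellAvg_le
      (fun s hs => hφ.pdy.pdy.abs_le hs (hy.midpt_mem_Icc hk)) hi) hj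
  have h4 := hx.abs_cellCorr_le (G := fun k => cellAvg y (fun t => pdx (pdx φ) (midpt x k, t)) j)
    hM (fun k hk => hy.abs_cellAvg_le
      (fun s hs => hφ.pdx.pdx.abs_le (hx.midpt_mem_Icc hk) hs) hj) hi
  rw [cellAvg_sub hcont (by fun_prop)] at h1
  rw [cellRecon]
  rw [abs_le] at *
  constructor <;> linarith [h1.1, h1.2, h2.1, h2.2, h3.1, h3.2, h4.1, h4.2]

lemma abs_edgeInterp_sub_le (hx : IsGrid x nx) (hy : IsGrid y ny) (hf : HasCkBound 3 f M)
    (hf' : HasCkBound 3 (pdx f) M) {i j : ℕ} (hi : i ≤ nx) (hj : j < ny) {s t : ℝ}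
    (hst : s = y j ∧ t = y (j + 1) ∨ s = y (j + 1) ∧ t = y j) :
    |edgeInterp x y nx ny f i j - (f (x i, s)
      + 6 * s * (1 - s) * ∑ k ∈ range ny, hMid y k ^ 3 / 6 * pdy (pdy f) (x i, midpt y k)
      + nodeCorr x nx (fun k => pdx (pdx (pdx f)) (midpt x k, s)) i
      + pdy f (x i, s) * (t - s) / 2)| ≤ 4 * (hmax x nx ^ 2 + hmax y ny ^ 2) * M * hMid y j := by
  have hM := hf.nonneg
  have hl := hy.hMid_pos hj
  have hxi := hx.mem_Icc hi
  have hs : s ∈ Set.Icc (0 : ℝ) 1 := by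
    rcases hst with ⟨rfl, rfl⟩ | ⟨rfl, rfl⟩
    exacts [hy.mem_Icc hj.le, hy.mem_Icc hj]
  have ht : t ∈ Set.Icc (0 : ℝ) 1 := by
    rcases hst with ⟨rfl, rfl⟩ | ⟨rfl, rfl⟩
    exacts [hy.mem_Icc hj, hy.mem_Icc hj.le]
  have hne : s ≠ t := by
    have := (hy.2.2 j hj).ne
    rcases hst with ⟨rfl, rfl⟩ | ⟨rfl, rfl⟩
    exacts [this, this.symm]
  have habs : |t - s| = hMid y j := by
    rcases hst with ⟨rfl, rfl⟩ | ⟨rfl, rfl⟩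
    · exact abs_of_pos hl
    · rw [abs_sub_comm]
      exact abs_of_pos hl
  have hmid : midpt y j ∈ Set.uIcc s t := by
    have := hy.2.2 j hj
    have hm : midpt y j ∈ Set.Icc (y j) (y (j + 1)) := by
      unfold midpt
      constructor <;> linarith
    rcases hst with ⟨rfl, rfl⟩ | ⟨rfl, rfl⟩
    · rwa [Set.uIcc_of_le this.le]
    · rwa [Set.uIcc_of_ge this.le]
  have havg : ∀ g : ℝ → ℝ, (∫ r in s..t, g r) / (t - s) = cellAvg y g j := by
    intro g
    rcases hst with ⟨rfl, rfl⟩ | ⟨rfl, rfl⟩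
    · rfl
    · rw [intervalIntegral.integral_symm, neg_div, ← div_neg, neg_sub]
      rfl
  have hslope : (smoothStep t - smoothStep s) / (t - s) =
      (smoothStep (y (j + 1)) - smoothStep (y j)) / hMid y j := by
    rcases hst with ⟨rfl, rfl⟩ | ⟨rfl, rfl⟩
    · rfl
    · rw [← neg_div_neg_eq, neg_sub, neg_sub]
      rfl
  have h1 := abs_average_taylor_le hM hne (fun t => hasDerivAt_pdy hf.differentiable (x i) t)
    (fun t => hasDerivAt_pdy hf.pdy.differentiable (x i) t)
    (fun t => hasDerivAt_pdy hf.pdy.pdy.differentiable (x i) t)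
    (fun t ht => hf.pdy.pdy.pdy.abs_le hxi ht) hs ht hmid
  have h2 := abs_slope_smoothStep_sub_le hs ht hne
  have hκ := hy.abs_sum_cube_mul_le' (G := fun k => pdy (pdy f) (x i, midpt y k)) hM
    fun k hk => hf.pdy.pdy.abs_le hxi (hy.midpt_mem_Icc hk)
  have h3 := mul_le_mul h2 hκ (abs_nonneg _) (by positivity)
  have h4 := hx.abs_nodeCorr_le
    (G := fun k => cellAvg y (fun t => pdx (pdx (pdx f)) (midpt x k, t)) j
      - pdx (pdx (pdx f)) (midpt x k, s)) (M := M * |t - s|) (by positivity) (fun k hk => by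
        rw [← havg]
        exact abs_average_sub_le hM hne
          (fun t => hasDerivAt_pdy hf'.pdx.pdx.differentiable (midpt x k) t)
          (fun t ht => hf'.pdx.pdx.pdy.abs_le (hx.midpt_mem_Icc hk) ht) hs ht) hi
  rw [nodeCorr_sub, habs] at h4
  rw [← abs_mul, habs, hslope] at h3
  rw [havg, habs, ← sq_abs (t - s), habs] at h1
  have h5 : 2 * M * hMid y j ^ 3 ≤ 2 * M * hmax y ny ^ 2 * hMid y j := by
    have := mul_le_mul_of_nonneg_left (hy.hMid_sq_le hj) (by positivity : 0 ≤ 2 * M * hMid y j)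
    linarith
  have h6 : 0 ≤ M * hmax x nx ^ 2 * hMid y j := by positivity
  have h7 : 0 ≤ M * hmax y ny ^ 2 * hMid y j := by positivity
  rw [edgeInterp, cellCorr]
  rw [abs_le] at *
  constructor <;> linarith [h1.1, h1.2, h3.1, h3.2, h4.1, h4.2]

/-- The node difference quotients of the interpolant are second-order accurate. -/
lemma abs_DyE_edgeInterp_sub_le (hx : IsGrid x nx) (hy : IsGrid y ny) (hny : 0 < ny)
    (hf : HasCkBound 3 f M) (hf' : HasCkBound 3 (pdx f) M)
    (h0 : ∀ t ∈ Set.Icc (0 : ℝ) 1, f (t, 0) = 0) (h1 : ∀ t ∈ Set.Icc (0 : ℝ) 1, f (t, 1) = 0)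
    {i j : ℕ} (hi : i ≤ nx) (hj : j ≤ ny) :
    |DyE y ny (edgeInterp x y nx ny f) 0 0 i j - pdy f (x i, y j)| ≤
      8 * (hmax x nx ^ 2 + hmax y ny ^ 2) * M := by
  have hvan : ∀ b, (∀ t ∈ Set.Icc (0 : ℝ) 1, f (t, b) = 0) → ∀ k < nx,
      pdx (pdx (pdx f)) (midpt x k, b) = 0 := fun b hb k hk =>
    pdx_eq_zero_of_Ioo (pdx_eq_zero_of_Ioo (pdx_eq_zero_of_Ioo
      fun t ht => hb t (Set.Ioo_subset_Icc_self ht))) _ (hx.midpt_mem_Ioo hk)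
  have h := abs_DyE_sub_le hy hny (v := edgeInterp x y nx ny f) (i := i)
    (c := fun j => f (x i, y j) + 6 * y j * (1 - y j) *
        (∑ k ∈ range ny, hMid y k ^ 3 / 6 * pdy (pdy f) (x i, midpt y k))
        + nodeCorr x nx (fun k => pdx (pdx (pdx f)) (midpt x k, y j)) i)
    (d := fun j => pdy f (x i, y j)) (K := 4 * (hmax x nx ^ 2 + hmax y ny ^ 2) * M)
    (fun j hj => by
      simpa [hMid] using abs_edgeInterp_sub_le hx hy hf hf' hi hj (Or.inl ⟨rfl, rfl⟩))
    (fun j hj => by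
      have := abs_edgeInterp_sub_le hx hy hf hf' hi hj (Or.inr ⟨rfl, rfl⟩)
      rw [← neg_sub (y (j + 1)) (y j), mul_neg, neg_div, ← sub_eq_add_neg] at this
      exact this)
    (by
      rw [hy.1, h0 _ (hx.mem_Icc hi), nodeCorr_eq_zero (hvan 0 h0)]
      ring)
    (by
      rw [hy.2.1, h1 _ (hx.mem_Icc hi), nodeCorr_eq_zero (hvan 1 h1)]
      ring) hj
  exact h.trans (le_of_eq (by ring))

end Interpolant

/-! ### Discrete stability -/

section Stability

variable {x y : ℕ → ℝ} {nx ny : ℕ}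

lemma sum_momentum_eq (hx : IsGrid x nx) (hy : IsGrid y ny) (hnx : 0 < nx) (hny : 0 < ny)
    (E F e : ℕ → ℕ → ℝ) (h0 : ∀ j < ny, e 0 j = 0) (h1 : ∀ j < ny, e nx j = 0) :
    ∑ i ∈ range nx, ∑ j ∈ range ny,
        hMid x i * hMid y j * (E i j * ((e (i + 1) j - e i j) / hMid x i))
      + ∑ i ∈ range (nx + 1), ∑ j ∈ range (ny + 1),
        hNode x nx i * hNode y ny j * (F i j * DyE y ny e 0 0 i j) =
      -∑ i ∈ Ico 1 nx, ∑ j ∈ range ny, hNode x nx i * hMid y j *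
        (((E i j - E (i - 1) j) / hNode x nx i + (F i (j + 1) - F i j) / hMid y j) * e i j) := by
  have hM : ∑ i ∈ range nx, ∑ j ∈ range ny,
        hMid x i * hMid y j * (E i j * ((e (i + 1) j - e i j) / hMid x i)) =
      -∑ i ∈ Ico 1 nx, ∑ j ∈ range ny, hMid y j * ((E i j - E (i - 1) j) * e i j) := by
    rw [sum_comm, sum_comm (s := Ico 1 nx), ← sum_neg_distrib]
    refine sum_congr rfl fun j hj => ?_
    rw [mem_range] at hj
    rw [← mul_sum, ← mul_neg, ← sum_mul_sub_eq_neg_sum_Ico hnx (fun i => E i j) (fun i => e i j)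
      (h0 j hj) (h1 j hj), mul_sum]
    refine sum_congr rfl fun i hi => ?_
    have := (hx.hMid_pos (mem_range.1 hi)).ne'
    field_simp
  have hT : ∑ i ∈ range (nx + 1), ∑ j ∈ range (ny + 1),
        hNode x nx i * hNode y ny j * (F i j * DyE y ny e 0 0 i j) =
      -∑ i ∈ Ico 1 nx, ∑ j ∈ range ny, hNode x nx i * ((F i (j + 1) - F i j) * e i j) := by
    have h : ∀ i ∈ range (nx + 1), ∑ j ∈ range (ny + 1),
        hNode x nx i * hNode y ny j * (F i j * DyE y ny e 0 0 i j) =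
        -∑ j ∈ range ny, hNode x nx i * ((F i (j + 1) - F i j) * e i j) := by
      intro i _
      rw [← mul_sum, ← mul_neg, ← sum_hNode_mul_DyE hy hny e i (F i), mul_sum]
      exact sum_congr rfl fun j _ => mul_assoc _ _ _
    rw [sum_congr rfl h, sum_neg_distrib, neg_inj]
    refine (sum_subset (fun i hi => ?_) fun i hi hi' => ?_).symm
    · simp only [mem_Ico, mem_range] at *
      omega
    · simp only [mem_Ico, mem_range] at *
      refine sum_eq_zero fun j hj => ?_
      rw [mem_range] at hj
      rcases (by omega : i = 0 ∨ i = nx) with rfl | rfl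
      · rw [h0 j hj, mul_zero, mul_zero]
      · rw [h1 j hj, mul_zero, mul_zero]
  rw [hM, hT, ← neg_add, ← sum_add_distrib, neg_inj]
  refine sum_congr rfl fun i hi => ?_
  rw [← sum_add_distrib]
  refine sum_congr rfl fun j hj => ?_
  have := (hx.hNode_pos hnx (mem_Ico.1 hi).2.le).ne'
  have := (hy.hMid_pos (mem_range.1 hj)).ne'
  field_simp

lemma sum_momentum_le (hx : IsGrid x nx) (hy : IsGrid y ny) (hnx : 0 < nx) (hny : 0 < ny)
    {E F e : ℕ → ℕ → ℝ} {r : ℝ} (h0 : ∀ j < ny, e 0 j = 0) (h1 : ∀ j < ny, e nx j = 0)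
    (hr : ∀ i, 1 ≤ i → i < nx → ∀ j < ny,
      |(E i j - E (i - 1) j) / hNode x nx i + (F i (j + 1) - F i j) / hMid y j| ≤ r)
    (hr0 : 0 ≤ r) :
    ∑ i ∈ range nx, ∑ j ∈ range ny,
        hMid x i * hMid y j * (E i j * ((e (i + 1) j - e i j) / hMid x i))
      + ∑ i ∈ range (nx + 1), ∑ j ∈ range (ny + 1),
        hNode x nx i * hNode y ny j * (F i j * DyE y ny e 0 0 i j) ≤
      ∑ i ∈ range nx, ∑ j ∈ range ny,
        hMid x i * hMid y j * (r * |(e (i + 1) j - e i j) / hMid x i|) := by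
  rw [sum_momentum_eq hx hy hnx hny E F e h0 h1, ← sum_neg_distrib]
  have hS : ∀ j < ny, 0 ≤ hMid y j * (r * ∑ i ∈ range nx, |e (i + 1) j - e i j|) := fun j hj =>
    mul_nonneg (hy.hMid_pos hj).le (mul_nonneg hr0 (sum_nonneg fun _ _ => abs_nonneg _))
  calc ∑ i ∈ Ico 1 nx, -∑ j ∈ range ny, hNode x nx i * hMid y j *
        (((E i j - E (i - 1) j) / hNode x nx i + (F i (j + 1) - F i j) / hMid y j) * e i j)
      ≤ ∑ i ∈ Ico 1 nx, ∑ j ∈ range ny,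
          hNode x nx i * (hMid y j * (r * ∑ k ∈ range nx, |e (k + 1) j - e k j|)) := by
        refine sum_le_sum fun i hi => ?_
        rw [← sum_neg_distrib]
        refine sum_le_sum fun j hj => ?_
        rw [mem_Ico] at hi
        rw [mem_range] at hj
        have hp := hx.hNode_pos hnx hi.2.le
        have hq := hy.hMid_pos hj
        rw [mul_assoc, ← mul_neg, ← mul_neg]
        refine mul_le_mul_of_nonneg_left (mul_le_mul_of_nonneg_left ?_ hq.le) hp.le
        refine (neg_le_abs _).trans ?_
        rw [abs_mul]
        exact mul_le_mul (hr i hi.1 hi.2 j hj)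
          (abs_le_sum_abs_sub (fun k => e k j) (h0 j hj) hi.2.le) (abs_nonneg _) hr0
    _ = (∑ i ∈ Ico 1 nx, hNode x nx i) *
          ∑ j ∈ range ny, hMid y j * (r * ∑ k ∈ range nx, |e (k + 1) j - e k j|) := by
        rw [sum_mul_sum]
    _ ≤ 1 * ∑ j ∈ range ny, hMid y j * (r * ∑ k ∈ range nx, |e (k + 1) j - e k j|) :=
        mul_le_mul_of_nonneg_right (hx.sum_Ico_hNode_le hnx)
          (sum_nonneg fun j hj => hS j (mem_range.1 hj))
    _ = _ := by
        rw [one_mul, sum_comm]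
        refine sum_congr rfl fun j _ => ?_
        rw [mul_sum, mul_sum]
        refine sum_congr rfl fun i hi => ?_
        have hp := hx.hMid_pos (mem_range.1 hi)
        rw [abs_div, abs_of_pos hp]
        field_simp

lemma sub_sq_le_mul_sub (α β p q r a b E11 E22 : ℝ) (hα : 0 < α) (hβ : 0 < β) (hβα : β ≤ α)
    (hr0 : 0 ≤ r) (hp : p = E11 + E22) (hq : q = E11 - E22)
    (ha : |a - (α * q + β * p)| ≤ r) (hb : |b - (-(α * q) + β * p)| ≤ r)
    (hab : |a + b - 2 * β * p| ≤ 4 * β * r) :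
    α / 2 * q ^ 2 + β / 2 * p ^ 2 - (10 * α + 1 / (2 * α) + 4) * r ^ 2 ≤
      E11 * a + E22 * b - r * |a| - r * |b| := by
  have h1 : E11 * a + E22 * b = p / 2 * (a + b) + q / 2 * (a - b) := by
    rw [hp, hq]; ring
  have h2 : β * p ^ 2 - 2 * β * r * |p| ≤ p / 2 * (a + b) := by
    have h : |p * (a + b - 2 * β * p)| ≤ |p| * (4 * β * r) := by
      rw [abs_mul]; gcongr
    linarith [(abs_le.1 h).1]
  have h3 : α * q ^ 2 - r * |q| ≤ q / 2 * (a - b) := by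
    have h : |q * (a - b - 2 * α * q)| ≤ |q| * (2 * r) := by
      rw [abs_mul]
      gcongr
      rw [abs_le] at *
      constructor <;> linarith [ha.1, ha.2, hb.1, hb.2]
    linarith [(abs_le.1 h).1]
  have h4 : |α * q| = α * |q| := by rw [abs_mul, abs_of_pos hα]
  have h5 : |β * p| = β * |p| := by rw [abs_mul, abs_of_pos hβ]
  have h6 : |a| ≤ α * |q| + β * |p| + r := by
    calc |a| = |(a - (α * q + β * p)) + (α * q) + β * p| := by congr 1; ring
      _ ≤ _ := (abs_add_three _ _ _).trans (by linarith)
  have h7 : |b| ≤ α * |q| + β * |p| + r := by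
    calc |b| = |(b - (-(α * q) + β * p)) + -(α * q) + β * p| := by congr 1; ring
      _ ≤ _ := (abs_add_three _ _ _).trans (by rw [abs_neg]; linarith)
  have h8 := mul_le_mul_of_nonneg_left (add_le_add h6 h7) hr0
  have h9 : 0 ≤ β / 2 * (|p| - 4 * r) ^ 2 := by positivity
  have h10 : 0 ≤ α / 2 * (|q| - (1 + 2 * α) / α * r) ^ 2 := by positivity
  have h11 : α / 2 * (|q| - (1 + 2 * α) / α * r) ^ 2 =
      α / 2 * |q| ^ 2 - (1 + 2 * α) * (|q| * r) + (1 / (2 * α) + 2 + 2 * α) * r ^ 2 := by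
    field_simp
    ring
  have h12 : β * r ^ 2 ≤ α * r ^ 2 := by gcongr
  rw [h11, sq_abs] at h10
  have h13 : β / 2 * (|p| - 4 * r) ^ 2 = β / 2 * p ^ 2 - 4 * (β * (|p| * r)) + 8 * (β * r ^ 2) := by
    rw [← sq_abs p]; ring
  rw [h13] at h9
  rw [h1]
  linarith

/-- Stability of the scheme in the energy norm. -/
lemma mac_energy_le {lam mu r : ℝ} (hlam : 0 < lam) (hmu : 0 < mu)
    (hx : IsGrid x nx) (hy : IsGrid y ny) (hnx : 0 < nx) (hny : 0 < ny) (hr0 : 0 ≤ r)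
    {ex ey E11 E22 E12 : ℕ → ℕ → ℝ}
    (hex0 : ∀ j < ny, ex 0 j = 0) (hex1 : ∀ j < ny, ex nx j = 0)
    (hey0 : ∀ i < nx, ey i 0 = 0) (hey1 : ∀ i < nx, ey i ny = 0)
    (h11 : ∀ i < nx, ∀ j < ny, |(ex (i + 1) j - ex i j) / hMid x i -
      (1 / (4 * mu) * (E11 i j - E22 i j) + 1 / (4 * (lam + mu)) * (E11 i j + E22 i j))| ≤ r)
    (h22 : ∀ i < nx, ∀ j < ny, |(ey i (j + 1) - ey i j) / hMid y j -
      (-(1 / (4 * mu) * (E11 i j - E22 i j)) + 1 / (4 * (lam + mu)) * (E11 i j + E22 i j))| ≤ r)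
    (htr : ∀ i < nx, ∀ j < ny,
      |(ex (i + 1) j - ex i j) / hMid x i + (ey i (j + 1) - ey i j) / hMid y j -
        2 * (1 / (4 * (lam + mu))) * (E11 i j + E22 i j)| ≤ 4 * (1 / (4 * (lam + mu))) * r)
    (h12 : ∀ i ≤ nx, ∀ j ≤ ny,
      |E12 i j - mu * (DyE y ny ex 0 0 i j + DxE x nx ey 0 0 i j)| ≤ mu * r)
    (hR1 : ∀ i, 1 ≤ i → i < nx → ∀ j < ny,
      |(E11 i j - E11 (i - 1) j) / hNode x nx i + (E12 i (j + 1) - E12 i j) / hMid y j| ≤ r)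
    (hR2 : ∀ i < nx, ∀ j, 1 ≤ j → j < ny →
      |(E12 (i + 1) j - E12 i j) / hMid x i + (E22 i j - E22 i (j - 1)) / hNode y ny j| ≤ r) :
    ∑ i ∈ range nx, ∑ j ∈ range ny, hMid x i * hMid y j *
        (1 / (4 * mu) / 2 * (E11 i j - E22 i j) ^ 2
          + 1 / (4 * (lam + mu)) / 2 * (E11 i j + E22 i j) ^ 2)
      + ∑ i ∈ range (nx + 1), ∑ j ∈ range (ny + 1),
        hNode x nx i * hNode y ny j * (1 / (2 * mu) * E12 i j ^ 2) ≤
      (5 / (2 * mu) + 3 * mu + 4) * r ^ 2 := by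
  have key1 := sum_momentum_le hx hy hnx hny hex0 hex1 hR1 hr0
  have key2 := sum_momentum_le (E := fun j i => E22 i j) (F := fun j i => E12 i j)
    (e := fun j i => ey i j) hy hx hny hnx hey0 hey1
    (fun j h1 h2 i hi => by rw [add_comm]; exact hR2 i hi j h1 h2) hr0
  rw [sum_comm, sum_comm (s := range (ny + 1)), sum_comm (t := range nx)] at key2
  have hsM : ∑ i ∈ range nx, ∑ j ∈ range ny, hMid x i * hMid y j * ((5 / (2 * mu) + 2 * mu + 4) * r ^ 2) =
      (5 / (2 * mu) + 2 * mu + 4) * r ^ 2 := by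
    simp_rw [← sum_mul, ← mul_sum, ← sum_mul]
    rw [hx.sum_hMid, hy.sum_hMid]
    ring
  have hsT : ∑ i ∈ range (nx + 1), ∑ j ∈ range (ny + 1),
      hNode x nx i * hNode y ny j * (mu * r ^ 2) = mu * r ^ 2 := by
    simp_rw [← sum_mul, ← mul_sum, ← sum_mul]
    rw [hx.sum_hNode hnx, hy.sum_hNode hny]
    ring
  have hM : ∑ i ∈ range nx, ∑ j ∈ range ny, hMid x i * hMid y j *
        (1 / (4 * mu) / 2 * (E11 i j - E22 i j) ^ 2
          + 1 / (4 * (lam + mu)) / 2 * (E11 i j + E22 i j) ^ 2) ≤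
      ∑ i ∈ range nx, ∑ j ∈ range ny,
          hMid x i * hMid y j * (E11 i j * ((ex (i + 1) j - ex i j) / hMid x i))
        + ∑ i ∈ range nx, ∑ j ∈ range ny,
          hMid y j * hMid x i * (E22 i j * ((ey i (j + 1) - ey i j) / hMid y j))
        - ∑ i ∈ range nx, ∑ j ∈ range ny,
          hMid x i * hMid y j * (r * |(ex (i + 1) j - ex i j) / hMid x i|)
        - ∑ i ∈ range nx, ∑ j ∈ range ny,
          hMid y j * hMid x i * (r * |(ey i (j + 1) - ey i j) / hMid y j|)
        + ∑ i ∈ range nx, ∑ j ∈ range ny,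
          hMid x i * hMid y j * ((5 / (2 * mu) + 2 * mu + 4) * r ^ 2) := by
    simp only [← sum_add_distrib, ← sum_sub_distrib]
    refine sum_le_sum fun i hi => sum_le_sum fun j hj => ?_
    rw [mem_range] at hi hj
    have h := sub_sq_le_mul_sub (1 / (4 * mu)) (1 / (4 * (lam + mu))) (E11 i j + E22 i j)
      (E11 i j - E22 i j) r ((ex (i + 1) j - ex i j) / hMid x i)
      ((ey i (j + 1) - ey i j) / hMid y j) (E11 i j) (E22 i j) (by positivity) (by positivity)
      (one_div_le_one_div_of_le (by positivity) (by linarith)) hr0 rfl rfl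
      (h11 i hi j hj) (h22 i hi j hj) (htr i hi j hj)
    have hK : 10 * (1 / (4 * mu)) + 1 / (2 * (1 / (4 * mu))) + 4 = 5 / (2 * mu) + 2 * mu + 4 := by
      field_simp
      ring
    rw [hK] at h
    have hw : 0 ≤ hMid x i * hMid y j := (mul_pos (hx.hMid_pos hi) (hy.hMid_pos hj)).le
    refine (mul_le_mul_of_nonneg_left (sub_le_iff_le_add.1 h) hw).trans (le_of_eq ?_)
    ring
  have hT : ∑ i ∈ range (nx + 1), ∑ j ∈ range (ny + 1),
        hNode x nx i * hNode y ny j * (1 / (2 * mu) * E12 i j ^ 2) ≤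
      ∑ i ∈ range (nx + 1), ∑ j ∈ range (ny + 1),
          hNode x nx i * hNode y ny j * (E12 i j * DyE y ny ex 0 0 i j)
        + ∑ i ∈ range (nx + 1), ∑ j ∈ range (ny + 1),
          hNode y ny j * hNode x nx i * (E12 i j * DyE x nx (fun j i => ey i j) 0 0 j i)
        + ∑ i ∈ range (nx + 1), ∑ j ∈ range (ny + 1),
          hNode x nx i * hNode y ny j * (mu * r ^ 2) := by
    simp only [← sum_add_distrib]
    refine sum_le_sum fun i hi => sum_le_sum fun j hj => ?_
    rw [mem_range, Nat.lt_succ_iff] at hi hj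
    have hw : 0 ≤ hNode x nx i * hNode y ny j :=
      (mul_pos (hx.hNode_pos hnx hi) (hy.hNode_pos hny hj)).le
    have h := h12 i hi j hj
    change |E12 i j - mu * (DyE y ny ex 0 0 i j + DyE x nx (fun j i => ey i j) 0 0 j i)| ≤ _ at h
    have h' : 1 / (2 * mu) * E12 i j ^ 2 ≤
        E12 i j * (DyE y ny ex 0 0 i j + DyE x nx (fun j i => ey i j) 0 0 j i) + mu * r ^ 2 := by
      generalize DyE y ny ex 0 0 i j + DyE x nx (fun j i => ey i j) 0 0 j i = g at h ⊢
      have h1 : E12 i j ^ 2 - mu * g * E12 i j ≤ |E12 i j| * (mu * r) := by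
        have : |E12 i j * (E12 i j - mu * g)| ≤ |E12 i j| * (mu * r) := by
          rw [abs_mul]; gcongr
        linarith [(abs_le.1 this).2]
      have h2 : 0 ≤ (|E12 i j| - mu * r) ^ 2 + (mu * r) ^ 2 := by positivity
      have h3 : |E12 i j| ^ 2 = E12 i j ^ 2 := sq_abs _
      rw [one_div_mul_eq_div, div_le_iff₀ (by positivity)]
      linarith
    refine (mul_le_mul_of_nonneg_left h' hw).trans (le_of_eq ?_)
    ring
  linarith

end Stability

/-! ### Consistency -/

section Consistency

variable {x y : ℕ → ℝ} {n nx ny : ℕ} {M : ℝ}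

/-- Cell values with a second-order correction whose differences are second-order accurate at the
nodes of an arbitrary grid. -/
def centerCorr (x y : ℕ → ℝ) (s : ℝ × ℝ → ℝ) (i j : ℕ) : ℝ :=
  s (midpt x i, midpt y j) - hMid x i ^ 2 / 8 * pdx (pdx s) (midpt x i, midpt y j)

lemma abs_center_taylor_le (hM : 0 ≤ M) {g g₁ g₂ g₃ : ℝ → ℝ} (hg : ∀ t, HasDerivAt g (g₁ t) t)
    (hg₁ : ∀ t, HasDerivAt g₁ (g₂ t) t) (hg₂ : ∀ t, HasDerivAt g₂ (g₃ t) t)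
    (hb : ∀ t ∈ Set.Icc (0 : ℝ) 1, |g₃ t| ≤ M) {s t : ℝ} (hs : s ∈ Set.Icc (0 : ℝ) 1)
    (ht : t ∈ Set.Icc (0 : ℝ) 1) :
    |g t - (t - s) ^ 2 / 2 * g₂ t - g s - g₁ s * (t - s)| ≤ 2 * M * |t - s| ^ 3 := by
  have h1 := abs_taylor_three_le hM hg hg₁ hg₂ hb hs ht
  have h2 := mul_le_mul_of_nonneg_left (abs_sub_le_of_deriv hM hg₂ hb hs ht)
    (by positivity : 0 ≤ |t - s| ^ 2 / 2)
  have h3 : 0 ≤ M * |t - s| ^ 3 := by positivity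
  have h4 : |(t - s) ^ 2 / 2 * (g₂ t - g₂ s)| ≤ |t - s| ^ 2 / 2 * (M * |t - s|) := by
    rw [abs_mul, abs_of_nonneg (by positivity : 0 ≤ (t - s) ^ 2 / 2), ← sq_abs (t - s)]
    exact h2
  rw [abs_le] at *
  constructor <;> linarith [h1.1, h1.2, h4.1, h4.2]

lemma IsGrid.abs_centerCorr_sub_div_le (hx : IsGrid x nx) (hy : IsGrid y ny) {s : ℝ × ℝ → ℝ}
    (hs : HasCkBound 3 s M) {i j : ℕ} (hi : 1 ≤ i) (hi' : i < nx) (hj : j < ny) :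
    |(centerCorr x y s i j - centerCorr x y s (i - 1) j) / hNode x nx i
      - pdx s (x i, midpt y j)| ≤ hmax x nx ^ 2 * M := by
  obtain ⟨k, rfl⟩ : ∃ k, i = k + 1 := ⟨i - 1, by omega⟩
  have hM := hs.nonneg
  have ha := hx.hMid_pos hi'
  have hb := hx.hMid_pos (i := k) (by omega)
  have hp := hx.hNode_pos (by omega) hi'.le
  have T := fun t ht => abs_center_taylor_le (t := t) hM
    (fun t => hasDerivAt_pdx hs.differentiable t (midpt y j))
    (fun t => hasDerivAt_pdx hs.pdx.differentiable t (midpt y j))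
    (fun t => hasDerivAt_pdx hs.pdx.pdx.differentiable t (midpt y j))
    (fun t ht => hs.pdx.pdx.pdx.abs_le ht (hy.midpt_mem_Icc hj)) (hx.mem_Icc hi'.le) ht
  have h1 := T _ (hx.midpt_mem_Icc hi')
  have h2 := T _ (hx.midpt_mem_Icc (i := k) (by omega))
  have e1 : midpt x (k + 1) - x (k + 1) = hMid x (k + 1) / 2 := by unfold midpt hMid; ring
  have e2 : midpt x k - x (k + 1) = -(hMid x k / 2) := by unfold midpt hMid; ring
  rw [e1, abs_of_pos (half_pos ha)] at h1
  rw [e2, abs_neg, abs_of_pos (half_pos hb)] at h2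
  have h3 : M * hMid x (k + 1) ^ 3 ≤ M * hmax x nx ^ 2 * hMid x (k + 1) := by
    have := mul_le_mul_of_nonneg_left (hx.hMid_sq_le hi') (by positivity : 0 ≤ M * hMid x (k + 1))
    linarith
  have h4 : M * hMid x k ^ 3 ≤ M * hmax x nx ^ 2 * hMid x k := by
    have := mul_le_mul_of_nonneg_left (hx.hMid_sq_le (i := k) (by omega))
      (by positivity : 0 ≤ M * hMid x k)
    linarith
  have h5 : hNode x nx (k + 1) = hMid x (k + 1) / 2 + hMid x k / 2 := by
    rw [hNode_eq (by omega) hi'.le, if_pos hi', if_pos (by omega), Nat.add_sub_cancel]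
  have h6 : 0 ≤ M * hmax x nx ^ 2 * hMid x k := by positivity
  have h7 : 0 ≤ M * hmax x nx ^ 2 * hMid x (k + 1) := by positivity
  rw [div_sub' hp.ne', abs_div, abs_of_pos hp, div_le_iff₀ hp, Nat.add_sub_cancel, h5, centerCorr,
    centerCorr]
  rw [abs_le] at *
  constructor <;> linarith [h1.1, h1.2, h2.1, h2.2]

lemma IsGrid.abs_sub_div_sub_midpt_le (hy : IsGrid y ny) {s : ℝ × ℝ → ℝ}
    (hs : HasCkBound 3 s M) {a : ℝ} (ha : a ∈ Set.Icc (0 : ℝ) 1) {j : ℕ} (hj : j < ny) :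
    |(s (a, y (j + 1)) - s (a, y j)) / hMid y j - pdy s (a, midpt y j)| ≤ hmax y ny ^ 2 * M := by
  have hM := hs.nonneg
  have hl := hy.hMid_pos hj
  have T := fun t ht => abs_taylor_three_le (t := t) hM
    (fun t => hasDerivAt_pdy hs.differentiable a t)
    (fun t => hasDerivAt_pdy hs.pdy.differentiable a t)
    (fun t => hasDerivAt_pdy hs.pdy.pdy.differentiable a t)
    (fun t ht => hs.pdy.pdy.pdy.abs_le ha ht) (hy.midpt_mem_Icc hj) ht
  have h1 := T _ (hy.mem_Icc hj)
  have h2 := T _ (hy.mem_Icc hj.le)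
  have e1 : y (j + 1) - midpt y j = hMid y j / 2 := by unfold midpt hMid; ring
  have e2 : y j - midpt y j = -(hMid y j / 2) := by unfold midpt hMid; ring
  rw [e1, abs_of_pos (half_pos hl)] at h1
  rw [e2, abs_neg, abs_of_pos (half_pos hl)] at h2
  have h3 : M * hMid y j ^ 3 ≤ M * hmax y ny ^ 2 * hMid y j := by
    have := mul_le_mul_of_nonneg_left (hy.hMid_sq_le hj) (by positivity : 0 ≤ M * hMid y j)
    linarith
  have h4 : 0 ≤ M * hmax y ny ^ 2 * hMid y j := by positivity
  rw [div_sub' hl.ne', abs_div, abs_of_pos hl, div_le_iff₀ hl]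
  rw [abs_le] at *
  constructor <;> linarith [h1.1, h1.2, h2.1, h2.2]

lemma IsGrid.abs_centerCorr_sub_le (hx : IsGrid x nx) (hy : IsGrid y ny) {s : ℝ × ℝ → ℝ}
    (hs : HasCkBound 3 s M) {i j : ℕ} (hi : i < nx) (hj : j < ny) :
    |centerCorr x y s i j - s (midpt x i, midpt y j)| ≤ hmax x nx ^ 2 * M / 8 := by
  have h := mul_le_mul (hx.hMid_sq_le hi)
    (hs.pdx.pdx.abs_le (hx.midpt_mem_Icc hi) (hy.midpt_mem_Icc hj)) (abs_nonneg _) (sq_nonneg _)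
  rw [centerCorr, sub_sub_cancel_left, abs_neg, abs_mul, abs_of_nonneg (by positivity)]
  linarith

/-- The momentum residual of the exact stresses. -/
lemma abs_momentum_residual_le (hx : IsGrid x nx) (hy : IsGrid y ny) {s τ : ℝ × ℝ → ℝ}
    (hs : HasCkBound 3 s M) (hτ : HasCkBound 3 τ M) {Z F : ℕ → ℕ → ℝ} {i j : ℕ} (hi : 1 ≤ i)
    (hi' : i < nx) (hj : j < ny)
    (h : (Z i j - Z (i - 1) j) / hNode x nx i + (F i (j + 1) - F i j) / hMid y j =
      pdx s (x i, midpt y j) + pdy τ (x i, midpt y j)) :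
    |((Z i j - centerCorr x y s i j) - (Z (i - 1) j - centerCorr x y s (i - 1) j)) / hNode x nx i
      + ((F i (j + 1) - τ (x i, y (j + 1))) - (F i j - τ (x i, y j))) / hMid y j| ≤
      (hmax x nx ^ 2 + hmax y ny ^ 2) * M := by
  have h1 := hx.abs_centerCorr_sub_div_le hy hs hi hi' hj
  have h2 := hy.abs_sub_div_sub_midpt_le hτ (hx.mem_Icc hi'.le) hj
  rw [sub_sub_sub_comm (Z i j), sub_sub_sub_comm (F i (j + 1)),
    sub_div _ (centerCorr x y s i j - _), sub_div _ (τ (x i, y (j + 1)) - _)]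
  rw [abs_le] at *
  constructor <;> linarith [h1.1, h1.2, h2.1, h2.2]

lemma DyE_sub_eq {v w : ℕ → ℕ → ℝ} {v0 vn : ℕ → ℝ} {i : ℕ} (h0 : v0 i = 0) (hn : vn i = 0)
    (j : ℕ) : DyE y n (fun i j => v i j - w i j) 0 0 i j =
      DyE y n v v0 vn i j - DyE y n w 0 0 i j := by
  simp only [DyE, h0, hn, Pi.zero_apply]
  split_ifs <;> ring

/-- The energy norm of the error in the corrected stresses is of second order. -/
lemma mac_error_energy_le {lam mu U S : ℝ} (hlam : 0 < lam) (hmu : 0 < mu)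
    (hnx : 0 < nx) (hny : 0 < ny) (hx : IsGrid x nx) (hy : IsGrid y ny) {ux uy : ℝ × ℝ → ℝ}
    (hux : HasCkBound 3 ux U) (huy : HasCkBound 3 uy U)
    (hbd : ∀ p : ℝ × ℝ, p ∈ Set.Icc ((0 : ℝ), (0 : ℝ)) ((1 : ℝ), (1 : ℝ)) →
      (p.1 = 0 ∨ p.1 = 1 ∨ p.2 = 0 ∨ p.2 = 1) → ux p = 0 ∧ uy p = 0)
    {s11 s22 s12 : ℝ × ℝ → ℝ}
    (hs11 : ∀ p, s11 p = (lam + 2 * mu) * pdx ux p + lam * pdy uy p)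
    (hs22 : ∀ p, s22 p = lam * pdx ux p + (lam + 2 * mu) * pdy uy p)
    (hs12 : ∀ p, s12 p = mu * (pdy ux p + pdx uy p))
    (hb11 : HasCkBound 3 s11 S) (hb22 : HasCkBound 3 s22 S) (hb12 : HasCkBound 3 s12 S)
    {Wx : ℕ → ℕ → ℝ} {Wx0 Wxn : ℕ → ℝ} {Wy : ℕ → ℕ → ℝ} {Wy0 Wyn : ℕ → ℝ}
    {Z11 Z22 Z12 : ℕ → ℕ → ℝ}
    (hW : MACESol nx ny x y lam mu Wx Wx0 Wxn Wy Wy0 Wyn Z11 Z22 Z12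
      (fun i j => pdx s11 (x i, midpt y j) + pdy s12 (x i, midpt y j))
      (fun i j => pdx s12 (midpt x i, y j) + pdy s22 (midpt x i, y j)))
    {E11 E22 E12 : ℕ → ℕ → ℝ} (hE11 : E11 = fun i j => Z11 i j - centerCorr x y s11 i j)
    (hE22 : E22 = fun i j => Z22 i j - centerCorr y x (s22 ∘ Prod.swap) j i)
    (hE12 : E12 = fun i j => Z12 i j - s12 (x i, y j)) :
    ∑ i ∈ range nx, ∑ j ∈ range ny, hMid x i * hMid y j *
        (1 / (4 * mu) / 2 * (E11 i j - E22 i j) ^ 2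
          + 1 / (4 * (lam + mu)) / 2 * (E11 i j + E22 i j) ^ 2)
      + ∑ i ∈ range (nx + 1), ∑ j ∈ range (ny + 1),
        hNode x nx i * hNode y ny j * (1 / (2 * mu) * E12 i j ^ 2) ≤
      (5 / (2 * mu) + 3 * mu + 4) *
        ((16 + 10 / mu) * (hmax x nx ^ 2 + hmax y ny ^ 2) * (U + S)) ^ 2 := by
  obtain ⟨hWx, hWxb, hWy, hWyb, hc1, hc2, hsh, hm1, hm2⟩ := hW
  have hU := hux.nonneg
  have hS := hb11.nonneg
  set δ := hmax x nx ^ 2 + hmax y ny ^ 2 with hδ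
  have hδ0 : 0 ≤ δ := by positivity
  obtain ⟨α, hα⟩ : ∃ α, α = 1 / (4 * mu) := ⟨_, rfl⟩
  obtain ⟨β, hβ⟩ : ∃ β, β = 1 / (4 * (lam + mu)) := ⟨_, rfl⟩
  have hα0 : 0 < α := hα ▸ by positivity
  have hβ0 : 0 < β := hβ ▸ by positivity
  have hβα : β ≤ α := by
    rw [hα, hβ]
    exact one_div_le_one_div_of_le (by positivity) (by linarith)
  have hκ : 16 + 10 / mu = 16 + 40 * α := by rw [hα]; field_simp; ring
  have hd1 : pdx ux = fun p => (α + β) * s11 p + (β - α) * s22 p := by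
    funext p
    rw [hs11, hs22, hα, hβ]
    field_simp
    ring
  have hd2 : pdy uy = fun p => (β - α) * s11 p + (α + β) * s22 p := by
    funext p
    rw [hs11, hs22, hα, hβ]
    field_simp
    ring
  have habs1 : |α + β| = α + β := abs_of_pos (by positivity)
  have habs2 : |β - α| = α - β := by rw [abs_of_nonpos (by linarith)]; ring
  have hbx : HasCkBound 3 (pdx ux) (2 * α * S) := by
    rw [hd1]
    refine ((hb11.const_mul _).add (hb22.const_mul _)).mono (le_of_eq ?_)
    rw [habs1, habs2]
    ring
  have hby : HasCkBound 3 (pdy uy) (2 * α * S) := by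
    rw [hd2]
    refine ((hb11.const_mul _).add (hb22.const_mul _)).mono (le_of_eq ?_)
    rw [habs1, habs2]
    ring
  have hbt : HasCkBound 3 (fun p => pdx ux p + pdy uy p) (4 * β * S) := by
    have h : (fun p => pdx ux p + pdy uy p) = fun p => 2 * β * s11 p + 2 * β * s22 p := by
      funext p
      rw [hd1, hd2]
      ring
    rw [h]
    refine ((hb11.const_mul _).add (hb22.const_mul _)).mono (le_of_eq ?_)
    rw [abs_of_pos (by positivity)]
    ring
  have hcon1 : ∀ a b : ℝ, 1 / (2 * mu) * (a - lam / (2 * lam + 2 * mu) * (a + b)) =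
      α * (a - b) + β * (a + b) := by
    intro a b
    rw [hα, hβ]
    field_simp
    ring
  have hcon2 : ∀ a b : ℝ, 1 / (2 * mu) * (b - lam / (2 * lam + 2 * mu) * (a + b)) =
      -(α * (a - b)) + β * (a + b) := by
    intro a b
    rw [hα, hβ]
    field_simp
    ring
  have hmul : ∀ a b : ℝ, 0 ≤ a → 0 ≤ b → 0 ≤ a * δ * b := fun a b ha hb =>
    mul_nonneg (mul_nonneg ha hδ0) hb
  have p1 := hmul 1 S zero_le_one hS
  have p2 := hmul α S hα0.le hS
  have p3 := hmul 1 U zero_le_one hU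
  have p4 := hmul α U hα0.le hU
  have p5 := hmul β S hβ0.le hS
  have p6 : 0 ≤ (α - β) * δ * S := hmul _ S (by linarith) hS
  have p7 := hmul (β * α) S (by positivity) hS
  have p8 := hmul β U hβ0.le hU
  have p9 := hmul (β * α) U (by positivity) hU
  have hrec1 : ∀ i < nx, ∀ j < ny,
      |cellRecon x y nx ny (pdx ux) i j - pdx ux (midpt x i, midpt y j)| ≤ 6 * α * δ * S :=
    fun i hi j hj => (abs_cellRecon_sub_le hx hy hbx.of_succ hi hj).trans (le_of_eq (by ring))
  have hrec2 : ∀ i < nx, ∀ j < ny,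
      |cellRecon x y nx ny (pdy uy) i j - pdy uy (midpt x i, midpt y j)| ≤ 6 * α * δ * S :=
    fun i hi j hj => (abs_cellRecon_sub_le hx hy hby.of_succ hi hj).trans (le_of_eq (by ring))
  have hrect : ∀ i < nx, ∀ j < ny,
      |cellRecon x y nx ny (pdx ux) i j + cellRecon x y nx ny (pdy uy) i j
        - (pdx ux (midpt x i, midpt y j) + pdy uy (midpt x i, midpt y j))| ≤ 12 * β * δ * S :=
    fun i hi j hj => by
      rw [← cellRecon_add hbx.of_succ hby.of_succ]
      exact (abs_cellRecon_sub_le hx hy hbt.of_succ hi hj).trans (le_of_eq (by ring))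
  have hint1 : ∀ i < nx, ∀ j < ny,
      (Wx (i + 1) j - edgeInterp x y nx ny ux (i + 1) j - (Wx i j - edgeInterp x y nx ny ux i j))
        / hMid x i = α * (Z11 i j - Z22 i j) + β * (Z11 i j + Z22 i j)
          - cellRecon x y nx ny (pdx ux) i j := by
    intro i hi j hj
    rw [← edgeInterp_succ_sub hx hux.1 hi, ← hcon1, hc1 i hi j hj]
    ring
  have hint2 : ∀ i < nx, ∀ j < ny,
      (Wy i (j + 1) - edgeInterp y x ny nx (uy ∘ Prod.swap) (j + 1) i
          - (Wy i j - edgeInterp y x ny nx (uy ∘ Prod.swap) j i)) / hMid y j =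
        -(α * (Z11 i j - Z22 i j)) + β * (Z11 i j + Z22 i j)
          - cellRecon x y nx ny (pdy uy) i j := by
    intro i hi j hj
    have h1 := edgeInterp_succ_sub (ny := nx) (y := x) (j := i) hy huy.swap.1 hj
    have h2 : cellRecon y x ny nx (pdx (uy ∘ Prod.swap)) j i =
        cellRecon x y nx ny (pdy uy) i j := cellRecon_swap hby.continuous i j
    rw [← h2, ← h1, ← hcon2, hc2 i hi j hj]
    ring
  have hk11 : ∀ i < nx, ∀ j < ny,
      |centerCorr x y s11 i j - s11 (midpt x i, midpt y j)| ≤ δ * S / 8 := by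
    intro i hi j hj
    refine (hx.abs_centerCorr_sub_le hy hb11 hi hj).trans ?_
    gcongr
    exact le_add_of_nonneg_right (sq_nonneg _)
  have hk22 : ∀ i < nx, ∀ j < ny,
      |centerCorr y x (s22 ∘ Prod.swap) j i - s22 (midpt x i, midpt y j)| ≤ δ * S / 8 := by
    intro i hi j hj
    refine (hy.abs_centerCorr_sub_le hx hb22.swap hj hi).trans ?_
    gcongr
    exact le_add_of_nonneg_left (sq_nonneg _)
  have hz : ∀ t ∈ Set.Icc (0 : ℝ) 1, (ux (t, 0) = 0 ∧ uy (t, 0) = 0) ∧ (ux (t, 1) = 0 ∧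
      uy (t, 1) = 0) ∧ (ux (0, t) = 0 ∧ uy (0, t) = 0) ∧ (ux (1, t) = 0 ∧ uy (1, t) = 0) := by
    intro t ht
    refine ⟨hbd _ (mk_mem_unitSquare ht (by simp)) ?_, hbd _ (mk_mem_unitSquare ht (by simp)) ?_,
      hbd _ (mk_mem_unitSquare (by simp) ht) ?_, hbd _ (mk_mem_unitSquare (by simp) ht) ?_⟩ <;> simp
  subst hE11 hE22 hE12
  refine mac_energy_le (ex := fun i j => Wx i j - edgeInterp x y nx ny ux i j)
    (ey := fun i j => Wy i j - edgeInterp y x ny nx (uy ∘ Prod.swap) j i)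
    hlam hmu hx hy hnx hny (by positivity) ?_ ?_ ?_ ?_ ?_ ?_ ?_ ?_ ?_ ?_
  · intro j hj
    rw [(hWx j hj).1, edgeInterp_eq_zero hx hy (Or.inl rfl) (fun t ht => ?_) hj, sub_zero]
    rw [hx.1]
    exact (hz t ht).2.2.1.1
  · intro j hj
    rw [(hWx j hj).2, edgeInterp_eq_zero hx hy (Or.inr rfl) (fun t ht => ?_) hj, sub_zero]
    rw [hx.2.1]
    exact (hz t ht).2.2.2.1
  · intro i hi
    rw [(hWy i hi).1, edgeInterp_eq_zero hy hx (Or.inl rfl) (fun t ht => ?_) hi, sub_zero]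
    rw [hy.1]
    exact (hz t ht).1.2
  · intro i hi
    rw [(hWy i hi).2, edgeInterp_eq_zero hy hx (Or.inr rfl) (fun t ht => ?_) hi, sub_zero]
    rw [hy.2.1]
    exact (hz t ht).2.1.2
  · intro i hi j hj
    rw [← hα, ← hβ, hκ, hint1 i hi j hj]
    have h1 := hrec1 i hi j hj
    have h2 := hk11 i hi j hj
    have h3 := hk22 i hi j hj
    have h4 : pdx ux (midpt x i, midpt y j) = (α + β) * s11 (midpt x i, midpt y j)
      + (β - α) * s22 (midpt x i, midpt y j) := congrFun hd1 _
    have h5 : |(α + β) * (centerCorr x y s11 i j - s11 (midpt x i, midpt y j))| ≤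
        (α + β) * (δ * S / 8) := by rw [abs_mul, habs1]; gcongr
    have h6 : |(β - α) * (centerCorr y x (s22 ∘ Prod.swap) j i - s22 (midpt x i, midpt y j))| ≤
        (α - β) * (δ * S / 8) := by
      rw [abs_mul, habs2]; exact mul_le_mul_of_nonneg_left h3 (by linarith)
    rw [h4] at h1
    rw [abs_le] at *
    constructor <;> linarith [h1.1, h1.2, h5.1, h5.2, h6.1, h6.2]
  · intro i hi j hj
    rw [← hα, ← hβ, hκ, hint2 i hi j hj]
    have h1 := hrec2 i hi j hj
    have h2 := hk11 i hi j hj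
    have h3 := hk22 i hi j hj
    have h4 : pdy uy (midpt x i, midpt y j) = (β - α) * s11 (midpt x i, midpt y j)
      + (α + β) * s22 (midpt x i, midpt y j) := congrFun hd2 _
    have h5 : |(β - α) * (centerCorr x y s11 i j - s11 (midpt x i, midpt y j))| ≤
        (α - β) * (δ * S / 8) := by
      rw [abs_mul, habs2]; exact mul_le_mul_of_nonneg_left h2 (by linarith)
    have h6 : |(α + β) * (centerCorr y x (s22 ∘ Prod.swap) j i - s22 (midpt x i, midpt y j))| ≤
        (α + β) * (δ * S / 8) := by rw [abs_mul, habs1]; gcongr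
    rw [h4] at h1
    rw [abs_le] at *
    constructor <;> linarith [h1.1, h1.2, h5.1, h5.2, h6.1, h6.2]
  · intro i hi j hj
    rw [← hβ, hκ, hint1 i hi j hj, hint2 i hi j hj]
    have h1 := hrect i hi j hj
    have h4 : pdx ux (midpt x i, midpt y j) = (α + β) * s11 (midpt x i, midpt y j)
      + (β - α) * s22 (midpt x i, midpt y j) := congrFun hd1 _
    have h4' : pdy uy (midpt x i, midpt y j) = (β - α) * s11 (midpt x i, midpt y j)
      + (α + β) * s22 (midpt x i, midpt y j) := congrFun hd2 _
    have h5 : |2 * β * (centerCorr x y s11 i j - s11 (midpt x i, midpt y j))| ≤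
        2 * β * (δ * S / 8) := by
      rw [abs_mul, abs_of_pos (by positivity)]
      exact mul_le_mul_of_nonneg_left (hk11 i hi j hj) (by positivity)
    have h6 : |2 * β * (centerCorr y x (s22 ∘ Prod.swap) j i - s22 (midpt x i, midpt y j))| ≤
        2 * β * (δ * S / 8) := by
      rw [abs_mul, abs_of_pos (by positivity)]
      exact mul_le_mul_of_nonneg_left (hk22 i hi j hj) (by positivity)
    rw [h4, h4'] at h1
    rw [abs_le] at *
    constructor <;> linarith [h1.1, h1.2, h5.1, h5.2, h6.1, h6.2]
  · intro i hi j hj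
    have hUM : U ≤ U + 2 * α * S := le_add_of_nonneg_right (by positivity)
    have hSM : 2 * α * S ≤ U + 2 * α * S := le_add_of_nonneg_left hU
    have h1 := abs_DyE_edgeInterp_sub_le hx hy hny (hux.mono hUM) (hbx.mono hSM)
      (fun t ht => (hz t ht).1.1) (fun t ht => (hz t ht).2.1.1) hi hj
    have hby' : HasCkBound 3 (pdx (uy ∘ Prod.swap)) (U + 2 * α * S) := hby.swap.mono hSM
    have h2 := abs_DyE_edgeInterp_sub_le hy hx hnx (huy.swap.mono hUM) hby'
      (fun t ht => (hz t ht).2.2.1.2) (fun t ht => (hz t ht).2.2.2.2) hj hi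
    change |_ - pdx uy (x i, y j)| ≤ _ at h2
    have h3 := DyE_sub_eq (y := y) (n := ny) (v := Wx) (w := edgeInterp x y nx ny ux)
      (hWxb i hi).1 (hWxb i hi).2 j
    have h4 := DyE_sub_eq (y := x) (n := nx) (v := fun j i => Wy i j)
      (w := edgeInterp y x ny nx (uy ∘ Prod.swap)) (hWyb j hj).1 (hWyb j hj).2 i
    have h5 : DxE x nx (fun i j => Wy i j - edgeInterp y x ny nx (uy ∘ Prod.swap) j i) 0 0 i j =
      DxE x nx Wy Wy0 Wyn i j - DyE x nx (edgeInterp y x ny nx (uy ∘ Prod.swap)) 0 0 j i := h4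
    rw [h3, h5, hsh i hi j hj, hs12, ← mul_sub, ← mul_sub, abs_mul, abs_of_pos hmu, hκ]
    refine mul_le_mul_of_nonneg_left ?_ hmu.le
    rw [add_comm (hmax y ny ^ 2), ← hδ] at h2
    rw [← hδ] at h1
    rw [abs_le] at *
    constructor <;> linarith [h1.1, h1.2, h2.1, h2.2]
  · intro i hi hi' j hj
    refine (abs_momentum_residual_le hx hy hb11 hb12 hi hi' hj (hm1 i hi hi' j hj)).trans ?_
    rw [hκ, ← hδ]
    linarith
  · intro i hi j hj hj'
    have h := abs_momentum_residual_le (Z := fun j i => Z22 i j) (F := fun j i => Z12 i j)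
      hy hx hb22.swap hb12.swap hj hj' hi (by
        rw [add_comm]
        exact (hm2 i hi j hj hj').trans (add_comm _ _))
    rw [add_comm, add_comm (hmax y ny ^ 2), ← hδ] at h
    refine h.trans ?_
    rw [hκ]
    linarith

end Consistency

lemma ipM_self_le {x y : ℕ → ℝ} {nx ny : ℕ} (hx : IsGrid x nx) (hy : IsGrid y ny)
    {φ Q : ℕ → ℕ → ℝ} {B c d : ℝ} (hc : 0 ≤ c)
    (hQ : ∑ i ∈ range nx, ∑ j ∈ range ny, hMid x i * hMid y j * Q i j ≤ B)
    (h : ∀ i < nx, ∀ j < ny, φ i j ^ 2 ≤ c * Q i j + d) :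
    ipM x y nx ny φ φ ≤ c * B + d := by
  have hd : ∑ i ∈ range nx, ∑ j ∈ range ny, hMid x i * hMid y j * d = d := by
    simp_rw [← sum_mul, ← mul_sum, ← sum_mul]
    rw [hx.sum_hMid, hy.sum_hMid]
    ring
  refine le_trans ?_ (add_le_add_left (mul_le_mul_of_nonneg_left hQ hc) d)
  conv_rhs => rw [← hd, mul_sum, ← sum_add_distrib]
  refine sum_le_sum fun i hi => ?_
  rw [mul_sum, ← sum_add_distrib]
  refine sum_le_sum fun j hj => ?_
  rw [mem_range] at hi hj
  have hw : 0 ≤ hMid x i * hMid y j := (mul_pos (hx.hMid_pos hi) (hy.hMid_pos hj)).le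
  linarith [mul_le_mul_of_nonneg_left (h i hi j hj) hw]

lemma sq_add_le_energy {α β a b k e : ℝ} (hβ : 0 < β) (hβα : β ≤ α) (hk : |k| ≤ e) :
    (a + k) ^ 2 ≤ 2 / β * (α / 2 * (a - b) ^ 2 + β / 2 * (a + b) ^ 2) + 2 * e ^ 2 := by
  have h1 : k ^ 2 ≤ e ^ 2 := sq_le_sq' (abs_le.1 hk).1 (abs_le.1 hk).2
  have h2 : 2 / β * (β / 2 * (a - b) ^ 2 + β / 2 * (a + b) ^ 2) ≤
      2 / β * (α / 2 * (a - b) ^ 2 + β / 2 * (a + b) ^ 2) := by gcongr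
  have h3 : 2 / β * (β / 2 * (a - b) ^ 2 + β / 2 * (a + b) ^ 2) = 2 * a ^ 2 + 2 * b ^ 2 := by
    field_simp
    ring
  linarith [sq_nonneg (a - k), sq_nonneg b]

/-- Second-order convergence of the MAC-E stresses: there are `C, h₀ > 0` depending
only on `μ` and the mesh-regularity constant `C₀` (independent of `h` and `l`) such
that, if `max(h,l) ≤ h₀`, then
`‖Z¹² - σ¹²‖_T ≤ Cμ(h²+l²)(‖u‖_{3,∞} + ‖σ‖_{3,∞})`,
`‖Z¹¹ - σ¹¹‖_M ≤ C(λ+μ)(h²+l²)(‖u‖_{3,∞} + ‖σ‖_{3,∞})`, and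
`‖Z²² - σ²²‖_M ≤ C(λ+μ)(h²+l²)(‖u‖_{3,∞} + ‖σ‖_{3,∞})`, where `σ¹²` is evaluated
at the grid nodes and `σ¹¹, σ²²` at the cell centers. -/
theorem mac_stress_convergence
    (mu C0 : ℝ) (hmu : 0 < mu) (hC0 : 0 < C0) :
    ∃ C > (0 : ℝ), ∃ h0 > (0 : ℝ), ∀ lam : ℝ, 0 < lam →
    ∀ (nx ny : ℕ), 2 ≤ nx → 2 ≤ ny → ∀ (x y : ℕ → ℝ),
    IsGrid x nx → IsGrid y ny →
    (∀ i < nx, C0 * max (hmax x nx) (hmax y ny) ≤ hMid x i) →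
    (∀ j < ny, C0 * max (hmax x nx) (hmax y ny) ≤ hMid y j) →
    max (hmax x nx) (hmax y ny) ≤ h0 →
    ∀ ux uy : ℝ × ℝ → ℝ, ContDiff ℝ 3 ux → ContDiff ℝ 3 uy →
    (∀ p : ℝ × ℝ, p ∈ Set.Icc ((0 : ℝ), (0 : ℝ)) ((1 : ℝ), (1 : ℝ)) →
      (p.1 = 0 ∨ p.1 = 1 ∨ p.2 = 0 ∨ p.2 = 1) → ux p = 0 ∧ uy p = 0) →
    ∀ s11 s22 s12 : ℝ × ℝ → ℝ,
    (∀ p, s11 p = (lam + 2 * mu) * pdx ux p + lam * pdy uy p) →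
    (∀ p, s22 p = lam * pdx ux p + (lam + 2 * mu) * pdy uy p) →
    (∀ p, s12 p = mu * (pdy ux p + pdx uy p)) →
    ContDiff ℝ 3 s11 → ContDiff ℝ 3 s22 → ContDiff ℝ 3 s12 →
    ∀ (Wx : ℕ → ℕ → ℝ) (Wx0 Wxn : ℕ → ℝ) (Wy : ℕ → ℕ → ℝ) (Wy0 Wyn : ℕ → ℝ)
      (Z11 Z22 Z12 : ℕ → ℕ → ℝ),
    MACESol nx ny x y lam mu Wx Wx0 Wxn Wy Wy0 Wyn Z11 Z22 Z12
      (fun i j => pdx s11 (x i, midpt y j) + pdy s12 (x i, midpt y j))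
      (fun i j => pdx s12 (midpt x i, y j) + pdy s22 (midpt x i, y j)) →
    Real.sqrt (ipT x y nx ny
          (fun i j => Z12 i j - s12 (x i, y j))
          (fun i j => Z12 i j - s12 (x i, y j)))
      ≤ C * mu * ((hmax x nx) ^ 2 + (hmax y ny) ^ 2)
          * (max (norm3 ux) (norm3 uy)
            + max (norm3 s11) (max (norm3 s22) (norm3 s12))) ∧
    Real.sqrt (ipM x y nx ny
          (fun i j => Z11 i j - s11 (midpt x i, midpt y j))
          (fun i j => Z11 i j - s11 (midpt x i, midpt y j)))
      ≤ C * (lam + mu) * ((hmax x nx) ^ 2 + (hmax y ny) ^ 2)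
          * (max (norm3 ux) (norm3 uy)
            + max (norm3 s11) (max (norm3 s22) (norm3 s12))) ∧
    Real.sqrt (ipM x y nx ny
          (fun i j => Z22 i j - s22 (midpt x i, midpt y j))
          (fun i j => Z22 i j - s22 (midpt x i, midpt y j)))
      ≤ C * (lam + mu) * ((hmax x nx) ^ 2 + (hmax y ny) ^ 2)
          * (max (norm3 ux) (norm3 uy)
            + max (norm3 s11) (max (norm3 s22) (norm3 s12))) := by
  obtain ⟨K, hK⟩ : ∃ K, K = 5 / (2 * mu) + 3 * mu + 4 := ⟨_, rfl⟩
  obtain ⟨κ, hκ⟩ : ∃ κ, κ = 16 + 10 / mu := ⟨_, rfl⟩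
  have hK0 : 0 < K := hK ▸ by positivity
  obtain ⟨C, hC⟩ : ∃ C, C = 8 * K * κ ^ 2 / mu + 1 / mu ^ 2 + 1 := ⟨_, rfl⟩
  have hC1 : 1 ≤ C := by rw [hC]; exact le_add_of_nonneg_left (by positivity)
  have hCC : C ≤ C ^ 2 := le_self_pow₀ hC1 two_ne_zero
  refine ⟨C, by linarith, 1, one_pos, ?_⟩
  intro lam hlam nx ny hnx hny x y hx hy _ _ _ ux uy hux huy hbd s11 s22 s12 hs11 hs22 hs12
    hc11 hc22 hc12 Wx Wx0 Wxn Wy Wy0 Wyn Z11 Z22 Z12 hW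
  obtain ⟨U, hU⟩ : ∃ U, U = max (norm3 ux) (norm3 uy) := ⟨_, rfl⟩
  obtain ⟨S, hS⟩ : ∃ S, S = max (norm3 s11) (max (norm3 s22) (norm3 s12)) := ⟨_, rfl⟩
  have hb11 : HasCkBound 3 s11 S := (hasCkBound_norm3 hc11).mono (hS ▸ le_max_left _ _)
  have hb22 : HasCkBound 3 s22 S := (hasCkBound_norm3 hc22).mono
    (hS ▸ (le_max_left _ _).trans (le_max_right _ _))
  have hb12 : HasCkBound 3 s12 S := (hasCkBound_norm3 hc12).mono
    (hS ▸ (le_max_right _ _).trans (le_max_right _ _))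
  have hbu : HasCkBound 3 ux U := (hasCkBound_norm3 hux).mono (hU ▸ le_max_left _ _)
  have hU0 := hbu.nonneg
  have hS0 := hb11.nonneg
  have hE := mac_error_energy_le hlam hmu (by omega) (by omega) hx hy hbu
    ((hasCkBound_norm3 huy).mono (hU ▸ le_max_right _ _)) hbd hs11 hs22 hs12 hb11 hb22 hb12 hW
    rfl rfl rfl
  have hδ : 0 ≤ hmax x nx ^ 2 + hmax y ny ^ 2 := by positivity
  rw [← hU, ← hS]
  rw [← hK, ← hκ] at hE
  have hwM : ∀ i ∈ range nx, ∀ j ∈ range ny, 0 ≤ hMid x i * hMid y j := fun i hi j hj =>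
    (mul_pos (hx.hMid_pos (mem_range.1 hi)) (hy.hMid_pos (mem_range.1 hj))).le
  have hwT : ∀ i ∈ range (nx + 1), ∀ j ∈ range (ny + 1), 0 ≤ hNode x nx i * hNode y ny j :=
    fun i hi j hj => (mul_pos (hx.hNode_pos (by omega) (Nat.lt_succ_iff.1 (mem_range.1 hi)))
      (hy.hNode_pos (by omega) (Nat.lt_succ_iff.1 (mem_range.1 hj)))).le
  have hEM := (le_add_of_nonneg_right (sum_nonneg fun i hi => sum_nonneg fun j hj =>
    mul_nonneg (hwT i hi j hj) (by positivity))).trans hE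
  have hET := (le_add_of_nonneg_left (sum_nonneg fun i hi => sum_nonneg fun j hj =>
    mul_nonneg (hwM i hi j hj) (by positivity))).trans hE
  have hx2 : hmax x nx ^ 2 * S / 8 ≤ (hmax x nx ^ 2 + hmax y ny ^ 2) * (U + S) / 8 := by
    gcongr
    · exact le_add_of_nonneg_right (sq_nonneg _)
    · exact le_add_of_nonneg_left hU0
  have hy2 : hmax y ny ^ 2 * S / 8 ≤ (hmax x nx ^ 2 + hmax y ny ^ 2) * (U + S) / 8 := by
    gcongr
    · exact le_add_of_nonneg_left (sq_nonneg _)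
    · exact le_add_of_nonneg_left hU0
  have hβ : 0 < 1 / (4 * (lam + mu)) := by positivity
  have hβα : 1 / (4 * (lam + mu)) ≤ 1 / (4 * mu) :=
    one_div_le_one_div_of_le (by positivity) (by linarith)
  have hcorr2 : ∀ i < nx, ∀ j < ny,
      |centerCorr y x (s22 ∘ Prod.swap) j i - s22 (midpt x i, midpt y j)| ≤
        hmax y ny ^ 2 * S / 8 := fun i hi j hj => hy.abs_centerCorr_sub_le hx hb22.swap hj hi
  have hM1 := ipM_self_le hx hy (φ := fun i j => Z11 i j - s11 (midpt x i, midpt y j))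
    (c := 2 / (1 / (4 * (lam + mu))))
    (d := 2 * ((hmax x nx ^ 2 + hmax y ny ^ 2) * (U + S) / 8) ^ 2) (by positivity) hEM fun i hi j hj => by
      have h := sq_add_le_energy (a := Z11 i j - centerCorr x y s11 i j)
        (b := Z22 i j - centerCorr y x (s22 ∘ Prod.swap) j i) hβ hβα
        ((hx.abs_centerCorr_sub_le hy hb11 hi hj).trans hx2)
      rwa [sub_add_sub_cancel] at h
  have hM2 := ipM_self_le hx hy (φ := fun i j => Z22 i j - s22 (midpt x i, midpt y j))
    (c := 2 / (1 / (4 * (lam + mu))))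
    (d := 2 * ((hmax x nx ^ 2 + hmax y ny ^ 2) * (U + S) / 8) ^ 2) (by positivity) hEM fun i hi j hj => by
      have h := sq_add_le_energy (a := Z22 i j - centerCorr y x (s22 ∘ Prod.swap) j i)
        (b := Z11 i j - centerCorr x y s11 i j) hβ hβα ((hcorr2 i hi j hj).trans hy2)
      rwa [sub_add_sub_cancel, ← neg_sub (Z11 i j - _), neg_sq,
        add_comm (Z22 i j - _) (Z11 i j - _)] at h
  have hT : ipT x y nx ny (fun i j => Z12 i j - s12 (x i, y j))
      (fun i j => Z12 i j - s12 (x i, y j)) ≤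
      2 * mu * (K * (κ * (hmax x nx ^ 2 + hmax y ny ^ 2) * (U + S)) ^ 2) := by
    refine le_trans (le_of_eq ?_)
      (mul_le_mul_of_nonneg_left hET (by positivity : (0 : ℝ) ≤ 2 * mu))
    simp only [ipT, mul_sum]
    refine sum_congr rfl fun i _ => sum_congr rfl fun j _ => ?_
    field_simp
  generalize hmax x nx ^ 2 + hmax y ny ^ 2 = δ at *
  have hDN : 0 ≤ (δ * (U + S)) ^ 2 := sq_nonneg _
  have hbound : 2 / (1 / (4 * (lam + mu))) * (K * (κ * δ * (U + S)) ^ 2)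
      + 2 * (δ * (U + S) / 8) ^ 2 ≤ (C * (lam + mu) * δ * (U + S)) ^ 2 := by
    have h1 : 8 * (lam + mu) * K * κ ^ 2 + 1 / 32 ≤ C ^ 2 * (lam + mu) ^ 2 := by
      have h2 : 8 * K * κ ^ 2 / mu * ((lam + mu) * mu) ≤ 8 * K * κ ^ 2 / mu * (lam + mu) ^ 2 := by
        refine mul_le_mul_of_nonneg_left ?_ (by positivity)
        rw [sq]
        gcongr
        linarith
      have h3 : 1 / mu ^ 2 * mu ^ 2 ≤ 1 / mu ^ 2 * (lam + mu) ^ 2 := by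
        gcongr
        linarith
      have h4 : 8 * K * κ ^ 2 / mu * ((lam + mu) * mu) = 8 * (lam + mu) * K * κ ^ 2 := by
        field_simp
      have h5 : 1 / mu ^ 2 * mu ^ 2 = 1 := by field_simp
      have h6 := mul_le_mul_of_nonneg_right hCC (sq_nonneg (lam + mu))
      rw [hC] at h6
      rw [hC]
      linarith [sq_nonneg (lam + mu)]
    have h2 : 2 / (1 / (4 * (lam + mu))) = 8 * (lam + mu) := by field_simp; norm_num
    rw [h2]
    linarith [mul_le_mul_of_nonneg_right h1 hDN]
  refine ⟨Real.sqrt_le_iff.2 ⟨by positivity, hT.trans ?_⟩,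
    Real.sqrt_le_iff.2 ⟨by positivity, hM1.trans hbound⟩,
    Real.sqrt_le_iff.2 ⟨by positivity, hM2.trans hbound⟩⟩
  have h1 : 2 * mu * K * κ ^ 2 ≤ C ^ 2 * mu ^ 2 := by
    have h2 : 8 * K * κ ^ 2 / mu * mu ^ 2 = 8 * mu * K * κ ^ 2 := by field_simp
    have h3 : 8 * K * κ ^ 2 / mu ≤ C ^ 2 := by
      refine le_trans ?_ hCC
      rw [hC, add_assoc]
      exact le_add_of_nonneg_right (by positivity)
    have h4 := mul_le_mul_of_nonneg_right h3 (sq_nonneg mu)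
    have h5 : 0 ≤ mu * K * κ ^ 2 := by positivity
    linarith
  linarith [mul_le_mul_of_nonneg_right h1 hDN]
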